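/- Let 1 < p ≤ q < ∞, r ∈ (0,∞), α ∈ (0,1], let 𝒮 be an η-sparse collection of dyadic cubes in ℝⁿ, and let ω, σ be weights on ℝⁿ. With the testing constants 𝒯 and 𝒯* as defined in the context, there is a constant C depending only on n, p, q, r, η such that ‖A^{r,α}_𝒮(·σ)‖^r_{L^p_σ → L^q_ω} ≤ C(𝒯 + 𝒯*) if r < p, and ‖A^{r,α}_𝒮(·σ)‖^r_{L^p_σ → L^q_ω} ≤ C·𝒯 if r ≥ p. Here ‖A^{r,α}_𝒮(·σ)‖_{L^p_σ → L^q_ω} denotes the least constant K with ‖A^{r,α}_𝒮(fσ)‖_{L^q_ω} ≤ K‖f‖_{L^p_σ} for all f ∈ L^p_σ. -/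

import Mathlib

open MeasureTheory ENNReal Set

noncomputable section

/-- An axis-parallel (closed) cube in ℝⁿ with corner `corner` and side length `side > 0`. -/
structure Cube (n : ℕ) where
  corner : Fin n → ℝ
  side : ℝ
  side_pos : 0 < side

namespace Cube

/-- The set of points of the cube. -/
def carrier {n : ℕ} (Q : Cube n) : Set (Fin n → ℝ) :=
  {x | ∀ i, Q.corner i ≤ x i ∧ x i ≤ Q.corner i + Q.side}

/-- The volume `|Q|` of the cube. -/
def vol {n : ℕ} (Q : Cube n) : ℝ := Q.side ^ n

/-- `Q` is a cube of the standard dyadic grid: `Q = 2^{-j}([0,1]^n + m)`. -/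
def IsDyadic {n : ℕ} (Q : Cube n) : Prop :=
  ∃ (j : ℤ) (m : Fin n → ℤ),
    Q.side = (2 : ℝ) ^ (-j) ∧ ∀ i, Q.corner i = (m i : ℝ) * (2 : ℝ) ^ (-j)

end Cube

/-- `η`-sparseness of a collection of cubes: there are pairwise disjoint measurable
subsets `E Q ⊆ Q` with `|E Q| ≥ η |Q|`. -/
def IsSparse {n : ℕ} (η : ℝ) (S : Set (Cube n)) : Prop :=
  ∃ E : Cube n → Set (Fin n → ℝ),
    (∀ Q ∈ S, MeasurableSet (E Q)) ∧ (∀ Q ∈ S, E Q ⊆ Q.carrier) ∧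
    (S.Pairwise (fun Q Q' => Disjoint (E Q) (E Q'))) ∧
    (∀ Q ∈ S, ENNReal.ofReal (η * Q.vol) ≤ volume (E Q))

/-- A weight: a nonnegative locally integrable function on ℝⁿ. -/
def IsWeight {n : ℕ} (w : (Fin n → ℝ) → ℝ) : Prop :=
  MeasureTheory.LocallyIntegrable w volume ∧ ∀ x, 0 ≤ w x

/-- `ω(Q) = ∫_Q ω`. -/
def wMass {n : ℕ} (w : (Fin n → ℝ) → ℝ) (Q : Cube n) : ℝ≥0∞ :=
  ∫⁻ x in Q.carrier, ENNReal.ofReal (w x)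

/-- The weighted `L^s` (quasi)norm `‖f‖_{L^s_w} = (∫ |f|^s w)^{1/s}`, valued in `ℝ≥0∞`. -/
def wNorm {n : ℕ} (s : ℝ) (w f : (Fin n → ℝ) → ℝ) : ℝ≥0∞ :=
  (∫⁻ x, ENNReal.ofReal (|f x| ^ s) * ENNReal.ofReal (w x)) ^ (1 / s)

/-- The weighted `L^s` (quasi)norm of an `ℝ≥0∞`-valued function. -/
def eNorm {n : ℕ} (s : ℝ) (w : (Fin n → ℝ) → ℝ) (g : (Fin n → ℝ) → ℝ≥0∞) : ℝ≥0∞ :=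
  (∫⁻ x, g x ^ s * ENNReal.ofReal (w x)) ^ (1 / s)

/-- `Σ_{Q ∈ D} g(Q) 1_Q`. -/
def cubeSum {n : ℕ} (D : Set (Cube n)) (g : Cube n → ℝ≥0∞) (x : Fin n → ℝ) : ℝ≥0∞ :=
  ∑' Q : D, Q.1.carrier.indicator (fun _ => g Q.1) x

/-- The sparse operator `A^{r,α}_S f = (Σ_{Q∈S} (|Q|^{-α} ∫_Q f)^r 1_Q)^{1/r}`
(for nonnegative `f`; negative values are truncated). -/
def sparseOp {n : ℕ} (S : Set (Cube n)) (r α : ℝ) (f : (Fin n → ℝ) → ℝ)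
    (x : Fin n → ℝ) : ℝ≥0∞ :=
  (cubeSum S
      (fun Q => ((ENNReal.ofReal Q.vol) ^ (-α) * ∫⁻ y in Q.carrier, ENNReal.ofReal (f y)) ^ r)
      x) ^ (1 / r)

/-- The Hardy–Littlewood maximal function over axis-parallel cubes. -/
def maximal {n : ℕ} (w : (Fin n → ℝ) → ℝ) (x : Fin n → ℝ) : ℝ≥0∞ :=
  ⨆ (Q : Cube n) (_ : x ∈ Q.carrier),
    (ENNReal.ofReal Q.vol)⁻¹ * ∫⁻ y in Q.carrier, ENNReal.ofReal |w y|

/-- The Fujii–Wilson `A∞`-characteristic `[w]_{A∞} = sup_Q ω(Q)⁻¹ ∫_Q M(1_Q ω)`. -/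
def AinfChar {n : ℕ} (w : (Fin n → ℝ) → ℝ) : ℝ≥0∞ :=
  ⨆ Q : Cube n, (wMass w Q)⁻¹ * ∫⁻ x in Q.carrier, maximal (Q.carrier.indicator w) x

/-- The two-weight characteristic
`[ω,σ]_{A^α_{pq}(S)} = sup_{Q∈S} |Q|^{-α} ω(Q)^{1/q} σ(Q)^{1/p'}` (here `1/p' = 1 - 1/p`). -/
def twoWeightChar {n : ℕ} (p q α : ℝ) (S : Set (Cube n)) (w σ' : (Fin n → ℝ) → ℝ) : ℝ≥0∞ :=
  ⨆ Q ∈ S, (ENNReal.ofReal Q.vol) ^ (-α) * wMass w Q ^ (1 / q) * wMass σ' Q ^ (1 - 1 / p)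

/-- The one-weight characteristic
`[w]_{A_{pq}} = sup_Q (|Q|⁻¹ ∫_Q w^q)(|Q|⁻¹ ∫_Q w^{-p'})^{q/p'}`, `p' = p/(p-1)`. -/
def ApqChar {n : ℕ} (p q : ℝ) (w : (Fin n → ℝ) → ℝ) : ℝ≥0∞ :=
  ⨆ Q : Cube n,
    ((ENNReal.ofReal Q.vol)⁻¹ * ∫⁻ x in Q.carrier, (ENNReal.ofReal (w x)) ^ q) *
      ((ENNReal.ofReal Q.vol)⁻¹ *
          ∫⁻ x in Q.carrier, (ENNReal.ofReal (w x)) ^ (-(p / (p - 1)))) ^ (q / (p / (p - 1)))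

/-- The testing constant `𝒯`. -/
def testT {n : ℕ} (p q r α : ℝ) (S : Set (Cube n)) (w σ' : (Fin n → ℝ) → ℝ) : ℝ≥0∞ :=
  ⨆ R ∈ S,
    wMass σ' R ^ (-(r / p)) *
      eNorm (q / r) w
        (cubeSum {Q | Q ∈ S ∧ Q.carrier ⊆ R.carrier}
          (fun Q => (ENNReal.ofReal Q.vol) ^ (-(α * r)) * wMass σ' Q ^ r))

/-- The testing constant `𝒯*`; here `1/(q/r)' = 1 - r/q` and `(p/r)' = (p/r)/((p/r)-1)`. -/
def testTstar {n : ℕ} (p q r α : ℝ) (S : Set (Cube n)) (w σ' : (Fin n → ℝ) → ℝ) : ℝ≥0∞ :=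
  ⨆ R ∈ S,
    wMass w R ^ (-(1 - r / q)) *
      eNorm ((p / r) / (p / r - 1)) σ'
        (cubeSum {Q | Q ∈ S ∧ Q.carrier ⊆ R.carrier}
          (fun Q => (ENNReal.ofReal Q.vol) ^ (-(α * r)) * wMass σ' Q ^ (r - 1) * wMass w Q))

/-- The operator (quasi)norm of `A^{r,α}_S(·σ) : L^p_σ → L^q_ω`, i.e. the least constant `K`
with `‖A^{r,α}_S(fσ)‖_{L^q_ω} ≤ K ‖f‖_{L^p_σ}` for all `f`. -/
def sparseOpNorm {n : ℕ} (p q r α : ℝ) (S : Set (Cube n)) (w σ' : (Fin n → ℝ) → ℝ) : ℝ≥0∞ :=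
  sInf {K : ℝ≥0∞ | ∀ f : (Fin n → ℝ) → ℝ, Measurable f →
    eNorm q w (sparseOp S r α (fun y => f y * σ' y)) ≤ K * wNorm p σ' f}

/-- A finite family of sets is laminar if any two of its members are nested or disjoint. -/
def IsLaminar {X : Type*} (D : Finset (Set X)) : Prop :=
  ∀ A ∈ D, ∀ B ∈ D, A ⊆ B ∨ B ⊆ A ∨ Disjoint A B

theorem IsLaminar.mono {X : Type*} {D D' : Finset (Set X)} (hD : IsLaminar D) (h : D' ⊆ D) :
    IsLaminar D' := fun A hA B hB => hD A (h hA) B (h hB)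

theorem IsLaminar.nested {X : Type*} {D : Finset (Set X)} (hD : IsLaminar D) {A B Q : Set X}
    (hA : A ∈ D) (hB : B ∈ D) (hQ : Q.Nonempty) (hQA : Q ⊆ A) (hQB : Q ⊆ B) :
    A ⊆ B ∨ B ⊆ A := by
  obtain ⟨x, hx⟩ := hQ
  rcases hD A hA B hB with h | h | h
  · exact Or.inl h
  · exact Or.inr h
  · exact absurd (hQB hx) (disjoint_left.1 h (hQA hx))

/-- Stopping (principal) sets of a finite laminar family with respect to a positive set function
`v`: every `Q` is contained in a stopping set `P Q` that controls `v Q`, and stopping sets of equal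
dyadic level `k` are disjoint. -/
structure IsStopping {X : Type*} (D : Finset (Set X)) (v : Set X → ℝ≥0∞) (P : Set X → Set X)
    (k : Set X → ℤ) : Prop where
  mem : ∀ Q ∈ D, P Q ∈ D
  subset : ∀ Q ∈ D, Q ⊆ P Q
  idem : ∀ Q ∈ D, P (P Q) = P Q
  lt_val : ∀ Q ∈ D, (2 : ℝ≥0∞) ^ k (P Q) < v (P Q)
  val_le : ∀ Q ∈ D, v (P Q) ≤ 2 ^ (k (P Q) + 1)
  le_two_mul : ∀ Q ∈ D, v Q ≤ 2 * v (P Q)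
  eq_of_between : ∀ Q ∈ D, ∀ Q' ∈ D, Q ⊆ Q' → Q' ⊆ P Q → P Q' = P Q
  disjoint : ∀ Q ∈ D, ∀ Q' ∈ D, k (P Q) = k (P Q') → P Q ≠ P Q' → Disjoint (P Q) (P Q')

theorem exists_isStopping {X : Type*} {D : Finset (Set X)} (hD : IsLaminar D)
    (hne : ∀ Q ∈ D, Q.Nonempty) {v : Set X → ℝ≥0∞} (hv0 : ∀ Q ∈ D, v Q ≠ 0)
    (hvt : ∀ Q ∈ D, v Q ≠ ⊤) :
    ∃ (P : Set X → Set X) (k : Set X → ℤ), IsStopping D v P k := by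
  classical
  have hlev : ∀ Q : Set X, ∃ l : ℤ, Q ∈ D → (2 : ℝ≥0∞) ^ l < v Q ∧ v Q ≤ 2 ^ (l + 1) := by
    intro Q
    by_cases hQ : Q ∈ D
    · obtain ⟨l, hl⟩ := ENNReal.exists_mem_Ioc_zpow (hv0 Q hQ) (hvt Q hQ)
        (by norm_num : (1 : ℝ≥0∞) < 2) (by norm_num)
      exact ⟨l, fun _ => hl⟩
    · exact ⟨0, fun h => absurd h hQ⟩
  choose l hl using hlev
  have hk : ∀ Q : Set X, ∃ k : ℤ, Q ∈ D → (∃ Q' ∈ D, Q ⊆ Q' ∧ l Q' = k) ∧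
      ∀ Q' ∈ D, Q ⊆ Q' → l Q' ≤ k := by
    intro Q
    by_cases hQ : Q ∈ D
    · obtain ⟨M, hM, hMax⟩ := (D.filter (Q ⊆ ·)).exists_max_image l
        ⟨Q, Finset.mem_filter.2 ⟨hQ, subset_rfl⟩⟩
      rw [Finset.mem_filter] at hM
      exact ⟨l M, fun _ => ⟨⟨M, hM.1, hM.2, rfl⟩,
        fun Q' h1 h2 => hMax Q' (Finset.mem_filter.2 ⟨h1, h2⟩)⟩⟩
    · exact ⟨0, fun h => absurd h hQ⟩
  choose k hk using hk
  have kanti : ∀ Q ∈ D, ∀ Q' ∈ D, Q ⊆ Q' → k Q' ≤ k Q := by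
    intro Q hQ Q' hQ' h
    obtain ⟨⟨M, hM, hQM, e⟩, -⟩ := hk Q' hQ'
    rw [← e]
    exact (hk Q hQ).2 M hM (h.trans hQM)
  have hP : ∀ Q : Set X, ∃ F : Set X, Q ∈ D → F ∈ D ∧ Q ⊆ F ∧ k F = k Q ∧
      ∀ Q' ∈ D, Q ⊆ Q' → k Q' = k Q → Q' ⊆ F := by
    intro Q
    by_cases hQ : Q ∈ D
    · obtain ⟨F, hF⟩ := (D.filter fun Q' => Q ⊆ Q' ∧ k Q' = k Q).exists_maximal
        ⟨Q, Finset.mem_filter.2 ⟨hQ, subset_rfl, rfl⟩⟩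
      have hF1 := Finset.mem_filter.1 hF.1
      refine ⟨F, fun _ => ⟨hF1.1, hF1.2.1, hF1.2.2, fun Q' h1 h2 h3 => ?_⟩⟩
      rcases hD.nested h1 hF1.1 (hne Q hQ) h2 hF1.2.1 with h | h
      · exact h
      · exact hF.2 (Finset.mem_filter.2 ⟨h1, h2, h3⟩) h
    · exact ⟨∅, fun h => absurd h hQ⟩
  choose P hP using hP
  have hbet : ∀ Q ∈ D, ∀ Q' ∈ D, Q ⊆ Q' → Q' ⊆ P Q → P Q' = P Q := by
    intro Q hQ Q' hQ' h1 h2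
    obtain ⟨a1, a2, a3, a4⟩ := hP Q hQ
    obtain ⟨b1, b2, b3, b4⟩ := hP Q' hQ'
    have e : k Q' = k Q :=
      le_antisymm (kanti Q hQ Q' hQ' h1) (a3 ▸ kanti Q' hQ' _ a1 h2)
    exact Subset.antisymm (a4 _ b1 (h1.trans b2) (b3.trans e)) (b4 _ a1 h2 (a3.trans e.symm))
  have hlk : ∀ Q ∈ D, l (P Q) = k (P Q) := by
    intro Q hQ
    obtain ⟨a1, a2, a3, a4⟩ := hP Q hQ
    obtain ⟨⟨M, hM, hPM, e⟩, -⟩ := hk (P Q) a1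
    have hkM : k M = k (P Q) :=
      le_antisymm (kanti _ a1 M hM hPM) (e ▸ (hk M hM).2 M hM subset_rfl)
    have := Subset.antisymm (a4 M hM (a2.trans hPM) (hkM.trans a3)) hPM
    calc l (P Q) = l M := by rw [this]
      _ = k (P Q) := e
  refine ⟨P, k, ⟨fun Q hQ => (hP Q hQ).1, fun Q hQ => (hP Q hQ).2.1, fun Q hQ => ?_,
    fun Q hQ => ?_, fun Q hQ => ?_, fun Q hQ => ?_, hbet, fun Q hQ Q' hQ' h hn => ?_⟩⟩
  · exact hbet Q hQ _ (hP Q hQ).1 (hP Q hQ).2.1 subset_rfl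
  · rw [← hlk Q hQ]
    exact (hl _ (hP Q hQ).1).1
  · rw [← hlk Q hQ]
    exact (hl _ (hP Q hQ).1).2
  · obtain ⟨a1, a2, a3, a4⟩ := hP Q hQ
    calc v Q ≤ 2 ^ (l Q + 1) := (hl Q hQ).2
      _ ≤ 2 ^ (k Q + 1) := by
        apply ENNReal.zpow_le_of_le (by norm_num)
        have := (hk Q hQ).2 Q hQ subset_rfl
        omega
      _ = 2 * 2 ^ (k Q) := by
        rw [ENNReal.zpow_add (by norm_num) (by norm_num), zpow_one, mul_comm]
      _ ≤ 2 * v (P Q) := by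
        rw [← a3, ← hlk Q hQ]
        gcongr
        exact (hl _ a1).1.le
  · obtain ⟨a1, a2, a3, a4⟩ := hP Q hQ
    obtain ⟨b1, b2, b3, b4⟩ := hP Q' hQ'
    rcases hD _ a1 _ b1 with h' | h' | h'
    · exact absurd (Subset.antisymm h' (a4 _ b1 (a2.trans h') (h.symm.trans a3))) hn
    · exact absurd (Subset.antisymm (b4 _ a1 (b2.trans h') (h.trans b3)) h') hn
    · exact h'

section

theorem sum_zpow_rpow_le {b : ℝ} (s : Finset ℤ) {y : ℝ≥0∞}
    (h : ∀ k ∈ s, (2 : ℝ≥0∞) ^ k ≤ y) (hb : 0 < b) :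
    ∑ k ∈ s, ((2 : ℝ≥0∞) ^ k) ^ b ≤ (1 - (2 : ℝ≥0∞) ^ (-b))⁻¹ * y ^ b := by
  classical
  rcases s.eq_empty_or_nonempty with rfl | hs
  · simp
  set K := s.max' hs with hK
  have hle : ∀ k ∈ s, k ≤ K := fun k hk => s.le_max' k hk
  have key : ∀ k ∈ s, ((2 : ℝ≥0∞) ^ k) ^ b =
      ((2 : ℝ≥0∞) ^ K) ^ b * ((2 : ℝ≥0∞) ^ (-b)) ^ (K - k).toNat := by
    intro k hk
    have h1 : (((K - k).toNat : ℕ) : ℝ) = (K : ℝ) - k := by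
      have : (((K - k).toNat : ℕ) : ℤ) = K - k := Int.toNat_of_nonneg (by linarith [hle k hk])
      exact_mod_cast congrArg (Int.cast : ℤ → ℝ) this
    rw [← ENNReal.rpow_intCast, ← ENNReal.rpow_intCast, ← ENNReal.rpow_natCast, h1,
      ← ENNReal.rpow_mul, ← ENNReal.rpow_mul, ← ENNReal.rpow_mul,
      ← ENNReal.rpow_add _ _ (by norm_num) (by norm_num)]
    congr 1
    ring
  rw [Finset.sum_congr rfl key, ← Finset.mul_sum, mul_comm]
  refine mul_le_mul' ?_ (ENNReal.rpow_le_rpow (h K (s.max'_mem hs)) hb.le)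
  have hinj : Set.InjOn (fun k : ℤ => (K - k).toNat) s := by
    intro k hk k' hk' hkk
    have h1 := hle k hk
    have h2 := hle k' hk'
    simp only at hkk
    omega
  rw [← Finset.sum_image (f := fun j : ℕ => ((2 : ℝ≥0∞) ^ (-b)) ^ j) hinj, ← ENNReal.tsum_geometric]
  exact ENNReal.sum_le_tsum _

/-- The constant in the dyadic Carleson embedding theorem for `L^a`. -/
def carlesonConst (a : ℝ) : ℝ≥0∞ := 2 * 4 ^ (a - 1) * (1 - (2 : ℝ≥0∞) ^ (-(a - 1)))⁻¹

theorem carlesonConst_ne_top {a : ℝ} (ha : 1 < a) : carlesonConst a ≠ ⊤ := by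
  unfold carlesonConst
  refine ENNReal.mul_ne_top (ENNReal.mul_ne_top (by norm_num)
    (ENNReal.rpow_ne_top_of_nonneg (by linarith) (by norm_num))) ?_
  rw [ENNReal.inv_ne_top, Ne, tsub_eq_zero_iff_le, not_le]
  exact ENNReal.rpow_lt_one_of_one_lt_of_neg (by norm_num) (by linarith)

variable {X : Type*} [MeasurableSpace X]

theorem sum_laverage_rpow_mul_le {a : ℝ} (ha : 1 < a) (μ : Measure X) {h : X → ℝ≥0∞}
    (hh : Measurable h) (𝓕 : Finset (Set X)) (k : Set X → ℤ)
    (hm : ∀ F ∈ 𝓕, MeasurableSet F) (hμ : ∀ F ∈ 𝓕, μ F ≠ ⊤)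
    (hlt : ∀ F ∈ 𝓕, (2 : ℝ≥0∞) ^ k F < ⨍⁻ x in F, h x ∂μ)
    (hle : ∀ F ∈ 𝓕, ⨍⁻ x in F, h x ∂μ ≤ 2 ^ (k F + 1))
    (hdisj : ∀ F ∈ 𝓕, ∀ F' ∈ 𝓕, k F = k F' → F ≠ F' → Disjoint F F') :
    ∑ F ∈ 𝓕, (⨍⁻ x in F, h x ∂μ) ^ a * μ F ≤ carlesonConst a * ∫⁻ x, h x ^ a ∂μ := by
  classical
  have ha1 : 0 < a - 1 := by linarith
  set s : Set X → Set X := fun F => F ∩ {x | (2 : ℝ≥0∞) ^ (k F - 1) < h x} with hs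
  have hsm : ∀ F ∈ 𝓕, MeasurableSet (s F) := fun F hF =>
    (hm F hF).inter (measurableSet_lt measurable_const hh)
  have two_ne : (2 : ℝ≥0∞) ≠ 0 := by norm_num
  have two_nt : (2 : ℝ≥0∞) ≠ ⊤ := by norm_num
  have hkk : ∀ j : ℤ, (2 : ℝ≥0∞) ^ j = 2 * 2 ^ (j - 1) := fun j => by
    conv_lhs => rw [show j = 1 + (j - 1) by ring, ENNReal.zpow_add two_ne two_nt, zpow_one]
  have hfin : ∀ j : ℤ, (2 : ℝ≥0∞) ^ j ≠ ⊤ := fun j => ENNReal.zpow_ne_top two_ne two_nt j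
  have h1 : ∀ F ∈ 𝓕, (⨍⁻ x in F, h x ∂μ) ^ a * μ F ≤
      2 * 4 ^ (a - 1) * ∫⁻ x, (s F).indicator (fun x => ((2 : ℝ≥0∞) ^ (k F - 1)) ^ (a - 1) * h x) x ∂μ := by
    intro F hF
    set v := ⨍⁻ x in F, h x ∂μ with hv
    have hvt : v ≠ ⊤ := ((hle F hF).trans_lt (lt_top_iff_ne_top.2 (hfin _))).ne
    have hvF : v * μ F = ∫⁻ x in F, h x ∂μ := by
      rw [mul_comm]; exact measure_mul_setLAverage _ (hμ F hF)
    have hsplit : ∫⁻ x in F, h x ∂μ ≤ ∫⁻ x in s F, h x ∂μ + 2 ^ (k F - 1) * μ F := by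
      rw [← lintegral_inter_add_sdiff h F (measurableSet_lt measurable_const hh :
        MeasurableSet {x | (2 : ℝ≥0∞) ^ (k F - 1) < h x})]
      gcongr
      calc ∫⁻ x in F \ {x | (2 : ℝ≥0∞) ^ (k F - 1) < h x}, h x ∂μ
          ≤ ∫⁻ x in F \ {x | (2 : ℝ≥0∞) ^ (k F - 1) < h x}, 2 ^ (k F - 1) ∂μ := by
            refine setLIntegral_mono measurable_const fun x hx => ?_
            simpa using hx.2
        _ ≤ 2 ^ (k F - 1) * μ F := by
            rw [setLIntegral_const]
            gcongr
            exact sdiff_subset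
    have hhalf : 2 * ((2 : ℝ≥0∞) ^ (k F - 1) * μ F) ≤ v * μ F := by
      rw [← mul_assoc, ← hkk]
      gcongr
      exact (hlt F hF).le
    have hbound : v * μ F ≤ 2 * ∫⁻ x in s F, h x ∂μ := by
      have hy : v * μ F ≠ ⊤ := ENNReal.mul_ne_top hvt (hμ F hF)
      have e1 : v * μ F + v * μ F ≤ 2 * (∫⁻ x in s F, h x ∂μ) + v * μ F := by
        calc v * μ F + v * μ F = 2 * (v * μ F) := (two_mul _).symm
          _ ≤ 2 * (∫⁻ x in s F, h x ∂μ + 2 ^ (k F - 1) * μ F) := by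
            rw [hvF]; gcongr
          _ ≤ 2 * (∫⁻ x in s F, h x ∂μ) + v * μ F := by
            rw [mul_add]; gcongr
      exact (ENNReal.add_le_add_iff_right hy).1 e1
    have hv4 : v ≤ 4 * 2 ^ (k F - 1) := by
      refine (hle F hF).trans_eq ?_
      rw [hkk, show k F + 1 - 1 = k F by ring, hkk, ← mul_assoc]
      norm_num
    rw [lintegral_indicator (hsm F hF), lintegral_const_mul _ hh]
    calc v ^ a * μ F = v ^ (a - 1) * (v * μ F) := by
          conv_lhs => rw [show a = (a - 1) + 1 by ring,
            ENNReal.rpow_add_of_nonneg _ _ ha1.le zero_le_one, ENNReal.rpow_one, mul_assoc]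
      _ ≤ (4 * 2 ^ (k F - 1)) ^ (a - 1) * (2 * ∫⁻ x in s F, h x ∂μ) := by
          gcongr
      _ = _ := by
          rw [ENNReal.mul_rpow_of_nonneg _ _ ha1.le]
          ring
  calc ∑ F ∈ 𝓕, (⨍⁻ x in F, h x ∂μ) ^ a * μ F
      ≤ ∑ F ∈ 𝓕, 2 * 4 ^ (a - 1) *
        ∫⁻ x, (s F).indicator (fun x => ((2 : ℝ≥0∞) ^ (k F - 1)) ^ (a - 1) * h x) x ∂μ :=
        Finset.sum_le_sum h1
    _ = 2 * 4 ^ (a - 1) * ∫⁻ x, ∑ F ∈ 𝓕,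
        (s F).indicator (fun x => ((2 : ℝ≥0∞) ^ (k F - 1)) ^ (a - 1) * h x) x ∂μ := by
        rw [← Finset.mul_sum, lintegral_finsetSum _ fun F hF => ?_]
        exact (hh.const_mul _).indicator (hsm F hF)
    _ ≤ 2 * 4 ^ (a - 1) * ∫⁻ x, (1 - (2 : ℝ≥0∞) ^ (-(a - 1)))⁻¹ * h x ^ a ∂μ := by
        gcongr with x
        simp only [indicator_apply]
        rw [← Finset.sum_filter, ← Finset.sum_mul]
        have hinj : Set.InjOn (fun F => k F - 1) (𝓕.filter fun F => x ∈ s F : Finset (Set X)) := by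
          intro F hF F' hF' e
          simp only [Finset.coe_filter, mem_ofPred_eq] at hF hF'
          by_contra hne
          exact disjoint_left.1 (hdisj F hF.1 F' hF'.1 (by simpa using e) hne) hF.2.1 hF'.2.1
        rw [← Finset.sum_image (f := fun j : ℤ => ((2 : ℝ≥0∞) ^ j) ^ (a - 1)) hinj]
        have : h x ^ a = h x ^ (a - 1) * h x := by
          conv_lhs => rw [show a = (a - 1) + 1 by ring,
            ENNReal.rpow_add_of_nonneg _ _ ha1.le zero_le_one, ENNReal.rpow_one]
        rw [this, ← mul_assoc]
        gcongr
        refine sum_zpow_rpow_le _ ?_ ha1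
        intro j hj
        obtain ⟨F, hF, rfl⟩ := Finset.mem_image.1 hj
        exact ((Finset.mem_filter.1 hF).2.2).le
    _ = carlesonConst a * ∫⁻ x, h x ^ a ∂μ := by
        rw [lintegral_const_mul _ (hh.pow_const a), ← mul_assoc]
        rfl

end

section

theorem sum_rpow_le_rpow_sum {ι : Type*} {t : ℝ} (ht : 1 ≤ t) (s : Finset ι) (f : ι → ℝ≥0∞) :
    ∑ i ∈ s, f i ^ t ≤ (∑ i ∈ s, f i) ^ t := by
  classical
  induction s using Finset.induction_on with
  | empty => simp
  | insert i s hi ih =>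
    rw [Finset.sum_insert hi, Finset.sum_insert hi]
    exact (add_le_add_right ih _).trans (ENNReal.add_rpow_le_rpow_add _ _ ht)

theorem rpow_sum_le_sum_rpow {ι : Type*} {t : ℝ} (ht0 : 0 < t) (ht : t ≤ 1) (s : Finset ι)
    (f : ι → ℝ≥0∞) : (∑ i ∈ s, f i) ^ t ≤ ∑ i ∈ s, f i ^ t := by
  classical
  induction s using Finset.induction_on with
  | empty => simp [ht0]
  | insert i s hi ih =>
    rw [Finset.sum_insert hi, Finset.sum_insert hi]
    exact (ENNReal.rpow_add_le_add_rpow _ _ ht0.le ht).trans (add_le_add_right ih _)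

/-- Hölder's inequality for finite sums with superconjugate exponents. -/
theorem sum_rpow_mul_rpow_le {ι : Type*} {a c : ℝ} (ha : 1 < a)
    (hac : 1 ≤ 1 / a + 1 / c) (s : Finset ι) (A B : ι → ℝ≥0∞) :
    ∑ i ∈ s, A i ^ (1 / a) * B i ^ (1 / c) ≤
      (∑ i ∈ s, A i) ^ (1 / a) * (∑ i ∈ s, B i) ^ (1 / c) := by
  have ha0 : 0 < a := by linarith
  have hconj : a.HolderConjugate (a / (a - 1)) := Real.HolderConjugate.conjExponent ha
  have hb0 : 0 < a / (a - 1) := hconj.symm.pos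
  have hb : 1 / (a / (a - 1)) = 1 - 1 / a := by field_simp
  refine (ENNReal.inner_le_Lp_mul_Lq s (fun i => A i ^ (1 / a)) (fun i => B i ^ (1 / c))
    hconj).trans ?_
  have e1 : ∀ i, (A i ^ (1 / a)) ^ a = A i := fun i => by
    rw [← ENNReal.rpow_mul, one_div_mul_cancel ha0.ne', ENNReal.rpow_one]
  simp only [e1, ← ENNReal.rpow_mul]
  gcongr
  set t := 1 / c * (a / (a - 1)) with ht
  have ht1 : 1 ≤ t := by
    rw [ht, ← div_le_iff₀ hb0, hb]
    linarith
  calc (∑ i ∈ s, B i ^ t) ^ (1 / (a / (a - 1)))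
      ≤ ((∑ i ∈ s, B i) ^ t) ^ (1 / (a / (a - 1))) := by
        gcongr
        exact sum_rpow_le_rpow_sum ht1 s B
    _ = (∑ i ∈ s, B i) ^ (1 / c) := by
        rw [← ENNReal.rpow_mul]
        congr 1
        rw [ht, mul_assoc, mul_one_div_cancel hb0.ne', mul_one]

theorem sum_indicator_const_rpow {X : Type*} {c : ℝ} (hc : 0 < c) (s : Finset (Set X))
    (hs : ∀ A ∈ s, ∀ B ∈ s, A ≠ B → Disjoint A B) (u : Set X → ℝ≥0∞) (x : X) :
    (∑ A ∈ s, A.indicator (fun _ => u A) x) ^ c = ∑ A ∈ s, A.indicator (fun _ => u A ^ c) x := by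
  classical
  by_cases hx : ∃ A ∈ s, x ∈ A
  · obtain ⟨A, hA, hxA⟩ := hx
    have hz : ∀ w : Set X → ℝ≥0∞, ∑ B ∈ s, B.indicator (fun _ => w B) x = w A := by
      intro w
      rw [Finset.sum_eq_single_of_mem A hA, indicator_of_mem hxA]
      intro B hB hBA
      exact indicator_of_notMem (disjoint_left.1 (hs A hA B hB hBA.symm) hxA) _
    rw [hz, hz]
  · push Not at hx
    rw [Finset.sum_eq_zero fun A hA => indicator_of_notMem (hx A hA) _,
      Finset.sum_eq_zero fun A hA => indicator_of_notMem (hx A hA) _, ENNReal.zero_rpow_of_pos hc]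

variable {X : Type*} [MeasurableSpace X]

theorem measurable_sum_indicator (B : Finset (Set X)) (hB : ∀ Q ∈ B, MeasurableSet Q)
    (c : Set X → ℝ≥0∞) : Measurable fun x => ∑ Q ∈ B, Q.indicator (fun _ => c Q) x :=
  Finset.measurable_fun_sum _ fun Q hQ => measurable_const.indicator (hB Q hQ)

theorem sum_mul_setLIntegral (ω : Measure X) (B : Finset (Set X))
    (hB : ∀ Q ∈ B, MeasurableSet Q) (m : Set X → ℝ≥0∞) {w : X → ℝ≥0∞} (hw : Measurable w) :
    ∑ Q ∈ B, m Q * ∫⁻ x in Q, w x ∂ω =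
      ∫⁻ x, (∑ Q ∈ B, Q.indicator (fun _ => m Q) x) * w x ∂ω := by
  simp_rw [Finset.sum_mul]
  have hmeas : ∀ Q ∈ B, Measurable fun x => Q.indicator (fun _ => m Q) x * w x :=
    fun Q hQ => (measurable_const.indicator (hB Q hQ)).mul hw
  rw [lintegral_finsetSum _ hmeas]
  refine Finset.sum_congr rfl fun Q hQ => ?_
  rw [← lintegral_const_mul _ hw, ← lintegral_indicator (hB Q hQ)]
  congr 1 with x
  by_cases hx : x ∈ Q <;> simp [hx]

theorem sum_mul_setLIntegral_le {c c' : ℝ} (hcc : c.HolderConjugate c') (ω : Measure X)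
    (B : Finset (Set X)) (hB : ∀ Q ∈ B, MeasurableSet Q) (m : Set X → ℝ≥0∞) {w : X → ℝ≥0∞}
    (hw : Measurable w) :
    ∑ Q ∈ B, m Q * ∫⁻ x in Q, w x ∂ω ≤
      (∫⁻ x, (∑ Q ∈ B, Q.indicator (fun _ => m Q) x) ^ c' ∂ω) ^ (1 / c') *
        (∫⁻ x, w x ^ c ∂ω) ^ (1 / c) := by
  rw [sum_mul_setLIntegral ω B hB m hw]
  exact ENNReal.lintegral_mul_le_Lp_mul_Lq ω hcc.symm
    (measurable_sum_indicator B hB m).aemeasurable hw.aemeasurable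

/-- The maximal members of `𝓕` strictly contained in `F`. -/
def children {X : Type*} (𝓕 : Finset (Set X)) (F : Set X) : Finset (Set X) :=
  open Classical in
  𝓕.filter fun F' => F' ⊂ F ∧ ∀ G ∈ 𝓕, G ⊂ F → F' ⊆ G → G = F'

/-- The part of `F` not covered by the strictly smaller members of `𝓕`. -/
def core {X : Type*} (𝓕 : Finset (Set X)) (F : Set X) : Set X :=
  F \ ⋃ F' ∈ children 𝓕 F, F'

theorem mem_children {X : Type*} {𝓕 : Finset (Set X)} {F F' : Set X} :
    F' ∈ children 𝓕 F ↔ F' ∈ 𝓕 ∧ F' ⊂ F ∧ ∀ G ∈ 𝓕, G ⊂ F → F' ⊆ G → G = F' := by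
  simp [children]

theorem exists_children {X : Type*} {𝓕 : Finset (Set X)} {F G : Set X} (hG : G ∈ 𝓕)
    (hGF : G ⊂ F) : ∃ F' ∈ children 𝓕 F, G ⊆ F' := by
  classical
  obtain ⟨M, hM⟩ := (𝓕.filter fun F' => F' ⊂ F ∧ G ⊆ F').exists_maximal
    ⟨G, Finset.mem_filter.2 ⟨hG, hGF, subset_rfl⟩⟩
  have h1 := Finset.mem_filter.1 hM.1
  refine ⟨M, mem_children.2 ⟨h1.1, h1.2.1, fun H hH hHF hMH => ?_⟩, h1.2.2⟩
  exact Subset.antisymm (hM.2 (Finset.mem_filter.2 ⟨hH, hHF, h1.2.2.trans hMH⟩) hMH) hMH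

theorem children_disjoint {X : Type*} {𝓕 : Finset (Set X)} (h𝓕 : IsLaminar 𝓕) {F : Set X} :
    ∀ A ∈ children 𝓕 F, ∀ B ∈ children 𝓕 F, A ≠ B → Disjoint A B := by
  intro A hA B hB hne
  rw [mem_children] at hA hB
  rcases h𝓕 A hA.1 B hB.1 with h | h | h
  · exact absurd (hA.2.2 B hB.1 hB.2.1 h).symm hne
  · exact absurd (hB.2.2 A hA.1 hA.2.1 h) hne
  · exact h

theorem children_pairwiseDisjoint {X : Type*} {𝓕 : Finset (Set X)} (h𝓕 : IsLaminar 𝓕)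
    (hne : ∀ F ∈ 𝓕, F.Nonempty) {F₁ F₂ : Set X} (h₁ : F₁ ∈ 𝓕) (h₂ : F₂ ∈ 𝓕) (hF : F₁ ≠ F₂) :
    Disjoint (children 𝓕 F₁) (children 𝓕 F₂) := by
  rw [Finset.disjoint_left]
  intro G hG₁ hG₂
  rw [mem_children] at hG₁ hG₂
  rcases h𝓕.nested h₁ h₂ (hne G hG₁.1) hG₁.2.1.subset hG₂.2.1.subset with h | h
  · have := hG₂.2.2 F₁ h₁ (h.ssubset_of_ne hF) hG₁.2.1.subset
    exact hG₁.2.1.ne this.symm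
  · have := hG₁.2.2 F₂ h₂ (h.ssubset_of_ne hF.symm) hG₂.2.1.subset
    exact hG₂.2.1.ne this.symm

theorem core_disjoint {X : Type*} {𝓕 : Finset (Set X)} (h𝓕 : IsLaminar 𝓕) {F₁ F₂ : Set X}
    (h₁ : F₁ ∈ 𝓕) (h₂ : F₂ ∈ 𝓕) (hF : F₁ ≠ F₂) : Disjoint (core 𝓕 F₁) (core 𝓕 F₂) := by
  have aux : ∀ {A B : Set X}, A ∈ 𝓕 → A ⊂ B → Disjoint A (core 𝓕 B) := by
    intro A B hA hAB
    obtain ⟨C, hC, hAC⟩ := exists_children hA hAB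
    refine disjoint_left.2 fun x hx hxB => hxB.2 ?_
    exact mem_biUnion hC (hAC hx)
  rcases h𝓕 F₁ h₁ F₂ h₂ with h | h | h
  · exact (aux h₁ (h.ssubset_of_ne hF)).mono_left sdiff_subset
  · exact ((aux h₂ (h.ssubset_of_ne hF.symm)).mono_left sdiff_subset).symm
  · exact h.mono sdiff_subset sdiff_subset

theorem measurableSet_core {𝓕 : Finset (Set X)} (hm : ∀ F ∈ 𝓕, MeasurableSet F) {F : Set X}
    (hF : F ∈ 𝓕) : MeasurableSet (core 𝓕 F) :=
  (hm F hF).diff (Finset.measurableSet_biUnion _ fun G hG => hm G (mem_children.1 hG).1)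

theorem sum_core_le (ω : Measure X) {𝓕 : Finset (Set X)} (h𝓕 : IsLaminar 𝓕)
    (hm : ∀ F ∈ 𝓕, MeasurableSet F) (w : X → ℝ≥0∞) :
    ∑ F ∈ 𝓕, ∫⁻ x in core 𝓕 F, w x ∂ω ≤ ∫⁻ x, w x ∂ω := by
  rw [← lintegral_biUnion_finset (fun A hA B hB h => core_disjoint h𝓕 hA hB h)
    (fun F hF => measurableSet_core hm hF)]
  exact setLIntegral_le_lintegral _ _

/-- Replacing `g` on the stopping children of `F` by its averages. -/
theorem sum_block_le {c c' : ℝ} (hcc : c.HolderConjugate c') (ω : Measure X)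
    {𝓕 : Finset (Set X)} (h𝓕 : IsLaminar 𝓕) (hm : ∀ F ∈ 𝓕, MeasurableSet F)
    (hω : ∀ F ∈ 𝓕, ω F ≠ ⊤) {F : Set X} (hF : F ∈ 𝓕) (B : Finset (Set X))
    (hB : ∀ Q ∈ B, MeasurableSet Q) (hBF : ∀ Q ∈ B, Q ⊆ F)
    (hBc : ∀ Q ∈ B, ∀ F' ∈ children 𝓕 F, F' ⊆ Q ∨ Disjoint F' Q)
    (m : Set X → ℝ≥0∞) {g : X → ℝ≥0∞} (hg : Measurable g) :
    ∑ Q ∈ B, m Q * ∫⁻ x in Q, g x ∂ω ≤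
      (∫⁻ x, (∑ Q ∈ B, Q.indicator (fun _ => m Q) x) ^ c' ∂ω) ^ (1 / c') *
        ((∫⁻ x in core 𝓕 F, g x ^ c ∂ω) ^ (1 / c) +
          (∑ F' ∈ children 𝓕 F, (⨍⁻ x in F', g x ∂ω) ^ c * ω F') ^ (1 / c)) := by
  have hc : 0 < c := hcc.pos
  have hcm : ∀ F' ∈ children 𝓕 F, MeasurableSet F' := fun F' h => hm F' (mem_children.1 h).1
  set w₁ : X → ℝ≥0∞ := (core 𝓕 F).indicator g with hw₁
  set w₂ : X → ℝ≥0∞ := fun x =>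
    ∑ F' ∈ children 𝓕 F, F'.indicator (fun _ => ⨍⁻ y in F', g y ∂ω) x with hw₂
  have hw₁m : Measurable w₁ := hg.indicator (measurableSet_core hm hF)
  have hw₂m : Measurable w₂ := measurable_sum_indicator _ hcm _
  have hloc : ∀ Q ∈ B, ∫⁻ x in Q, g x ∂ω ≤ ∫⁻ x in Q, w₁ x ∂ω + ∫⁻ x in Q, w₂ x ∂ω := by
    intro Q hQ
    calc ∫⁻ x in Q, g x ∂ω
        ≤ ∫⁻ x in Q, (w₁ x + ∑ F' ∈ children 𝓕 F, F'.indicator g x) ∂ω := by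
          refine setLIntegral_mono (hw₁m.add (Finset.measurable_fun_sum _ fun F' h =>
            hg.indicator (hcm F' h))) fun x hx => ?_
          by_cases hx' : x ∈ core 𝓕 F
          · rw [hw₁, indicator_of_mem hx']
            exact le_self_add
          · have : ∃ F' ∈ children 𝓕 F, x ∈ F' := by
              by_contra hcon
              push Not at hcon
              exact hx' ⟨hBF Q hQ hx, by simpa using hcon⟩
            obtain ⟨F', hF', hxF'⟩ := this
            refine le_add_left ?_
            refine le_trans ?_ (Finset.single_le_sum (f := fun F' => F'.indicator g x)
              (fun _ _ => zero_le) hF')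
            simp [hxF']
      _ = ∫⁻ x in Q, w₁ x ∂ω + ∑ F' ∈ children 𝓕 F, ∫⁻ x in Q, F'.indicator g x ∂ω := by
          rw [lintegral_add_left hw₁m, lintegral_finsetSum _ fun F' h => hg.indicator (hcm F' h)]
      _ ≤ ∫⁻ x in Q, w₁ x ∂ω + ∫⁻ x in Q, w₂ x ∂ω := by
          rw [hw₂, lintegral_finsetSum _ fun F' h => measurable_const.indicator (hcm F' h)]
          refine add_le_add_right (Finset.sum_le_sum fun F' hF' => ?_) _
          rw [lintegral_indicator (hcm F' hF'), lintegral_indicator (hcm F' hF'),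
            Measure.restrict_restrict (hcm F' hF'), setLIntegral_const]
          rcases hBc Q hQ F' hF' with h | h
          · rw [inter_eq_left.2 h, mul_comm,
              measure_mul_setLAverage _ (hω F' (mem_children.1 hF').1)]
          · rw [h.inter_eq]
            simp
  have h₁ : ∫⁻ x, w₁ x ^ c ∂ω = ∫⁻ x in core 𝓕 F, g x ^ c ∂ω := by
    rw [← lintegral_indicator (measurableSet_core hm hF)]
    congr 1 with x
    by_cases hx : x ∈ core 𝓕 F <;> simp [hw₁, hx, hc]
  have h₂ : ∫⁻ x, w₂ x ^ c ∂ω = ∑ F' ∈ children 𝓕 F, (⨍⁻ x in F', g x ∂ω) ^ c * ω F' := by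
    simp_rw [hw₂, sum_indicator_const_rpow hc _ (children_disjoint h𝓕)]
    rw [lintegral_finsetSum _ fun F' h => measurable_const.indicator (hcm F' h)]
    exact Finset.sum_congr rfl fun F' h => by rw [lintegral_indicator_const (hcm F' h)]
  calc ∑ Q ∈ B, m Q * ∫⁻ x in Q, g x ∂ω
      ≤ ∑ Q ∈ B, (m Q * ∫⁻ x in Q, w₁ x ∂ω + m Q * ∫⁻ x in Q, w₂ x ∂ω) :=
        Finset.sum_le_sum fun Q hQ => by rw [← mul_add]; gcongr; exact hloc Q hQ
    _ ≤ _ := by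
        rw [Finset.sum_add_distrib, mul_add, ← h₁, ← h₂]
        exact add_le_add (sum_mul_setLIntegral_le hcc ω B hB m hw₁m)
          (sum_mul_setLIntegral_le hcc ω B hB m hw₂m)

end

section

variable {X : Type*} [MeasurableSpace X]

theorem setLIntegral_ne_top_of_rpow {a : ℝ} (ha : 1 ≤ a) {μ : Measure X} {h : X → ℝ≥0∞}
    (hI : ∫⁻ x, h x ^ a ∂μ ≠ ⊤) {Q : Set X} (hQ : μ Q ≠ ⊤) : ∫⁻ x in Q, h x ∂μ ≠ ⊤ := by
  have hle : ∫⁻ x in Q, h x ∂μ ≤ ∫⁻ x in Q, (1 + h x ^ a) ∂μ := by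
    refine lintegral_mono fun x => ?_
    rcases le_total (h x) 1 with hx | hx
    · exact hx.trans le_self_add
    · refine le_add_left ?_
      calc h x = h x ^ (1 : ℝ) := (ENNReal.rpow_one _).symm
        _ ≤ h x ^ a := ENNReal.rpow_le_rpow_of_exponent_le hx ha
  refine (hle.trans_lt ?_).ne
  rw [lintegral_add_left measurable_const, setLIntegral_const, one_mul]
  exact ENNReal.add_lt_top.2 ⟨hQ.lt_top, (setLIntegral_le_lintegral _ _).trans_lt hI.lt_top⟩

theorem setLAverage_ne_top {μ : Measure X} {h : X → ℝ≥0∞} {Q : Set X}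
    (hI : ∫⁻ x in Q, h x ∂μ ≠ ⊤) : ⨍⁻ x in Q, h x ∂μ ≠ ⊤ := by
  rw [setLAverage_eq]
  by_cases h0 : μ Q = 0
  · rw [setLIntegral_measure_zero _ _ h0]
    simp
  · exact ENNReal.div_ne_top hI h0

theorem nonempty_of_setLAverage_ne_zero {μ : Measure X} {h : X → ℝ≥0∞} {Q : Set X}
    (hQ : ⨍⁻ x in Q, h x ∂μ ≠ 0) : Q.Nonempty := by
  rw [nonempty_iff_ne_empty]
  rintro rfl
  simp at hQ

theorem sum_stopping_le {a : ℝ} (ha : 1 < a) {μ : Measure X} {h : X → ℝ≥0∞}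
    (hh : Measurable h) {D : Finset (Set X)} (hm : ∀ Q ∈ D, MeasurableSet Q)
    (hμ : ∀ Q ∈ D, μ Q ≠ ⊤) {P : Set X → Set X} {k : Set X → ℤ}
    (hP : IsStopping D (fun Q => ⨍⁻ x in Q, h x ∂μ) P k) [DecidableEq (Set X)] :
    ∑ F ∈ D.image P, (⨍⁻ x in F, h x ∂μ) ^ a * μ F ≤ carlesonConst a * ∫⁻ x, h x ^ a ∂μ := by
  refine sum_laverage_rpow_mul_le ha μ hh _ k ?_ ?_ ?_ ?_ ?_
  · rintro F hF
    obtain ⟨Q, hQ, rfl⟩ := Finset.mem_image.1 hF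
    exact hm _ (hP.mem Q hQ)
  · rintro F hF
    obtain ⟨Q, hQ, rfl⟩ := Finset.mem_image.1 hF
    exact hμ _ (hP.mem Q hQ)
  · rintro F hF
    obtain ⟨Q, hQ, rfl⟩ := Finset.mem_image.1 hF
    exact hP.lt_val Q hQ
  · rintro F hF
    obtain ⟨Q, hQ, rfl⟩ := Finset.mem_image.1 hF
    exact hP.val_le Q hQ
  · rintro F hF F' hF'
    obtain ⟨Q, hQ, rfl⟩ := Finset.mem_image.1 hF
    obtain ⟨Q', hQ', rfl⟩ := Finset.mem_image.1 hF'
    exact hP.disjoint Q hQ Q' hQ'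

/-- The constant in the bilinear estimate below. -/
def bilinearConst (a c : ℝ) : ℝ≥0∞ :=
  2 * (carlesonConst a ^ (1 / a) * (1 + carlesonConst a ^ (1 / c)))

theorem bilinearConst_ne_top {a c : ℝ} (ha : 1 < a) (hc : 0 < c) : bilinearConst a c ≠ ⊤ := by
  have h := carlesonConst_ne_top ha
  have ha0 : 0 ≤ 1 / a := by positivity
  have hc0 : 0 ≤ 1 / c := by positivity
  unfold bilinearConst
  exact ENNReal.mul_ne_top (by norm_num) (ENNReal.mul_ne_top
    (ENNReal.rpow_ne_top_of_nonneg ha0 h)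
    (ENNReal.add_ne_top.2 ⟨by norm_num, ENNReal.rpow_ne_top_of_nonneg hc0 h⟩))

open Classical in
theorem bilinear_half_of_ne_zero {a c c' : ℝ} (ha : 1 < a) (hcc : c.HolderConjugate c')
    (hac : 1 ≤ 1 / a + 1 / c) {σ ω : Measure X} {D : Finset (Set X)} (hD : IsLaminar D)
    (hm : ∀ Q ∈ D, MeasurableSet Q) (hσ : ∀ Q ∈ D, σ Q ≠ ⊤) (hω : ∀ Q ∈ D, ω Q ≠ ⊤)
    {τ : Set X → ℝ≥0∞} {h g : X → ℝ≥0∞} (hh : Measurable h) (hg : Measurable g) {T κ : ℝ≥0∞}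
    (hT : ∀ R ∈ D, (∫⁻ x, (∑ Q ∈ D with Q ⊆ R, Q.indicator (fun _ => τ Q * σ Q) x) ^ c' ∂ω)
      ^ (1 / c') ≤ T * σ R ^ (1 / a))
    (hκ : ∀ Q ∈ D, (⨍⁻ x in Q, g x ∂ω) ^ c * ω Q ≤ κ * ((⨍⁻ x in Q, h x ∂σ) ^ a * σ Q))
    (hI : ∫⁻ x, h x ^ a ∂σ ≠ ⊤) (hκI : κ * ∫⁻ x, h x ^ a ∂σ ≤ ∫⁻ x, g x ^ c ∂ω)
    (hv0 : ∀ Q ∈ D, ⨍⁻ x in Q, h x ∂σ ≠ 0) :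
    ∑ Q ∈ D, τ Q * (∫⁻ x in Q, h x ∂σ) * (∫⁻ x in Q, g x ∂ω) ≤
      bilinearConst a c * T * (∫⁻ x, h x ^ a ∂σ) ^ (1 / a) * (∫⁻ x, g x ^ c ∂ω) ^ (1 / c) := by
  have ha0 : 0 < a := by linarith
  have hc0 : 0 < c := hcc.pos
  have hc'0 : 0 < c' := hcc.symm.pos
  have hne : ∀ Q ∈ D, Q.Nonempty := fun Q hQ => nonempty_of_setLAverage_ne_zero (hv0 Q hQ)
  obtain ⟨P, k, hP⟩ := exists_isStopping hD hne hv0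
    fun Q hQ => setLAverage_ne_top (setLIntegral_ne_top_of_rpow ha.le hI (hσ Q hQ))
  set v : Set X → ℝ≥0∞ := fun Q => ⨍⁻ x in Q, h x ∂σ with hv
  set u : Set X → ℝ≥0∞ := fun Q => ⨍⁻ x in Q, g x ∂ω with hu
  set Ih := ∫⁻ x, h x ^ a ∂σ with hIh
  set Ig := ∫⁻ x, g x ^ c ∂ω with hIg
  set 𝓕 := D.image P with h𝓕
  have hFD : 𝓕 ⊆ D := by
    intro F hF
    obtain ⟨Q, hQ, rfl⟩ := Finset.mem_image.1 hF
    exact hP.mem Q hQ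
  have hFP : ∀ F ∈ 𝓕, P F = F := by
    intro F hF
    obtain ⟨Q, hQ, rfl⟩ := Finset.mem_image.1 hF
    exact hP.idem Q hQ
  have hFl : IsLaminar 𝓕 := hD.mono hFD
  have hN : ∑ F ∈ 𝓕, v F ^ a * σ F ≤ carlesonConst a * Ih := sum_stopping_le ha hh hm hσ hP
  set A : Set X → ℝ≥0∞ := fun F => ∫⁻ x in core 𝓕 F, g x ^ c ∂ω with hA
  set Y : Set X → ℝ≥0∞ := fun F => ∑ F' ∈ children 𝓕 F, u F' ^ c * ω F' with hY
  have hAs : ∑ F ∈ 𝓕, A F ≤ Ig := sum_core_le ω hFl (fun F hF => hm F (hFD hF)) _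
  have hYs : ∑ F ∈ 𝓕, Y F ≤ carlesonConst a * Ig := by
    calc ∑ F ∈ 𝓕, Y F = ∑ F' ∈ 𝓕.biUnion (children 𝓕), u F' ^ c * ω F' := by
          rw [Finset.sum_biUnion]
          intro F₁ h₁ F₂ h₂ h₁₂
          exact children_pairwiseDisjoint hFl (fun F hF => hne F (hFD hF)) h₁ h₂ h₁₂
      _ ≤ ∑ F' ∈ 𝓕, u F' ^ c * ω F' := by
          refine Finset.sum_le_sum_of_subset fun F' hF' => ?_
          obtain ⟨F, -, hF⟩ := Finset.mem_biUnion.1 hF'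
          exact (mem_children.1 hF).1
      _ ≤ ∑ F' ∈ 𝓕, κ * (v F' ^ a * σ F') := Finset.sum_le_sum fun F' hF' => hκ F' (hFD hF')
      _ ≤ κ * (carlesonConst a * Ih) := by
          rw [← Finset.mul_sum]
          gcongr
      _ = carlesonConst a * (κ * Ih) := by ring
      _ ≤ carlesonConst a * Ig := by gcongr
  have hblock : ∀ F ∈ 𝓕, ∑ Q ∈ D with P Q = F,
      τ Q * (∫⁻ x in Q, h x ∂σ) * (∫⁻ x in Q, g x ∂ω) ≤
      2 * T * ((v F ^ a * σ F) ^ (1 / a) * A F ^ (1 / c) +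
        (v F ^ a * σ F) ^ (1 / a) * Y F ^ (1 / c)) := by
    intro F hF
    have hFmem := hFD hF
    set B := D.filter fun Q => P Q = F with hB
    have hBD : ∀ Q ∈ B, Q ∈ D ∧ P Q = F := fun Q hQ => Finset.mem_filter.1 hQ
    have hBF : ∀ Q ∈ B, Q ⊆ F := fun Q hQ => (hBD Q hQ).2 ▸ hP.subset Q (hBD Q hQ).1
    have hblk := sum_block_le hcc ω hFl (fun F hF => hm F (hFD hF)) (fun F hF => hω F (hFD hF)) hF B
      (fun Q hQ => hm Q (hBD Q hQ).1) hBF (by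
        intro Q hQ F' hF'
        obtain ⟨hF'1, hF'2, -⟩ := mem_children.1 hF'
        rcases hD F' (hFD hF'1) Q (hBD Q hQ).1 with hh | hh | hh
        · exact Or.inl hh
        · exfalso
          have h1 := hP.eq_of_between Q (hBD Q hQ).1 F' (hFD hF'1) hh
            ((hBD Q hQ).2 ▸ hF'2.subset)
          rw [hFP F' hF'1, (hBD Q hQ).2] at h1
          exact hF'2.ne h1
        · exact Or.inr hh) (fun Q => τ Q * σ Q) hg
    have htest : (∫⁻ x, (∑ Q ∈ B, Q.indicator (fun _ => τ Q * σ Q) x) ^ c' ∂ω) ^ (1 / c') ≤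
        T * σ F ^ (1 / a) := by
      refine le_trans ?_ (hT F hFmem)
      gcongr with x
      exact fun Q hQ => Finset.mem_filter.2 ⟨(hBD Q hQ).1, hBF Q hQ⟩
    calc ∑ Q ∈ B, τ Q * (∫⁻ x in Q, h x ∂σ) * (∫⁻ x in Q, g x ∂ω)
        ≤ ∑ Q ∈ B, 2 * v F * (τ Q * σ Q * ∫⁻ x in Q, g x ∂ω) := by
          refine Finset.sum_le_sum fun Q hQ => ?_
          obtain ⟨hQD, hQF⟩ := hBD Q hQ
          have h1 : ∫⁻ x in Q, h x ∂σ ≤ σ Q * (2 * v F) := by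
            rw [← measure_mul_setLAverage h (hσ Q hQD), ← hQF]
            gcongr
            exact hP.le_two_mul Q hQD
          calc τ Q * (∫⁻ x in Q, h x ∂σ) * (∫⁻ x in Q, g x ∂ω)
              ≤ τ Q * (σ Q * (2 * v F)) * (∫⁻ x in Q, g x ∂ω) := by gcongr
            _ = _ := by ring
      _ ≤ 2 * v F * ((T * σ F ^ (1 / a)) * (A F ^ (1 / c) + Y F ^ (1 / c))) := by
          rw [← Finset.mul_sum]
          gcongr
          exact hblk.trans (by gcongr)
      _ = _ := by
          rw [ENNReal.mul_rpow_of_nonneg _ _ (by positivity : (0 : ℝ) ≤ 1 / a), ← ENNReal.rpow_mul,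
            mul_one_div_cancel ha0.ne', ENNReal.rpow_one]
          ring
  calc ∑ Q ∈ D, τ Q * (∫⁻ x in Q, h x ∂σ) * (∫⁻ x in Q, g x ∂ω)
      = ∑ F ∈ 𝓕, ∑ Q ∈ D with P Q = F, τ Q * (∫⁻ x in Q, h x ∂σ) * (∫⁻ x in Q, g x ∂ω) :=
        (Finset.sum_fiberwise_of_maps_to (fun Q hQ => Finset.mem_image_of_mem P hQ) _).symm
    _ ≤ ∑ F ∈ 𝓕, 2 * T * ((v F ^ a * σ F) ^ (1 / a) * A F ^ (1 / c) +
        (v F ^ a * σ F) ^ (1 / a) * Y F ^ (1 / c)) := Finset.sum_le_sum hblock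
    _ ≤ 2 * T * ((carlesonConst a * Ih) ^ (1 / a) * Ig ^ (1 / c) +
        (carlesonConst a * Ih) ^ (1 / a) * (carlesonConst a * Ig) ^ (1 / c)) := by
        rw [← Finset.mul_sum, Finset.sum_add_distrib]
        gcongr
        · exact (sum_rpow_mul_rpow_le ha hac 𝓕 _ _).trans (by gcongr)
        · exact (sum_rpow_mul_rpow_le ha hac 𝓕 _ _).trans (by gcongr)
    _ = _ := by
        rw [ENNReal.mul_rpow_of_nonneg _ _ (by positivity : (0 : ℝ) ≤ 1 / a),
          ENNReal.mul_rpow_of_nonneg _ _ (by positivity : (0 : ℝ) ≤ 1 / c), bilinearConst]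
        ring

open Classical in
/-- The half of the two-weight bilinear estimate in which the `σ`-averages dominate. -/
theorem bilinear_half {a c c' : ℝ} (ha : 1 < a) (hcc : c.HolderConjugate c')
    (hac : 1 ≤ 1 / a + 1 / c) {σ ω : Measure X} {D : Finset (Set X)} (hD : IsLaminar D)
    (hm : ∀ Q ∈ D, MeasurableSet Q) (hσ : ∀ Q ∈ D, σ Q ≠ ⊤) (hω : ∀ Q ∈ D, ω Q ≠ ⊤)
    {τ : Set X → ℝ≥0∞} {h g : X → ℝ≥0∞} (hh : Measurable h) (hg : Measurable g) {T κ : ℝ≥0∞}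
    (hT : ∀ R ∈ D, (∫⁻ x, (∑ Q ∈ D with Q ⊆ R, Q.indicator (fun _ => τ Q * σ Q) x) ^ c' ∂ω)
      ^ (1 / c') ≤ T * σ R ^ (1 / a))
    {D' : Finset (Set X)} (hD' : D' ⊆ D)
    (hκ : ∀ Q ∈ D', (⨍⁻ x in Q, g x ∂ω) ^ c * ω Q ≤ κ * ((⨍⁻ x in Q, h x ∂σ) ^ a * σ Q))
    (hI : ∫⁻ x, h x ^ a ∂σ ≠ ⊤) (hκI : κ * ∫⁻ x, h x ^ a ∂σ ≤ ∫⁻ x, g x ^ c ∂ω) :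
    ∑ Q ∈ D', τ Q * (∫⁻ x in Q, h x ∂σ) * (∫⁻ x in Q, g x ∂ω) ≤
      bilinearConst a c * T * (∫⁻ x, h x ^ a ∂σ) ^ (1 / a) * (∫⁻ x, g x ^ c ∂ω) ^ (1 / c) := by
  have hc'0 : 0 < c' := hcc.symm.pos
  set D₁ := D'.filter fun Q => ⨍⁻ x in Q, h x ∂σ ≠ 0 with hD₁
  have hsub : D₁ ⊆ D := (Finset.filter_subset _ _).trans hD'
  have hsum : ∑ Q ∈ D', τ Q * (∫⁻ x in Q, h x ∂σ) * (∫⁻ x in Q, g x ∂ω) =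
      ∑ Q ∈ D₁, τ Q * (∫⁻ x in Q, h x ∂σ) * (∫⁻ x in Q, g x ∂ω) := by
    symm
    refine Finset.sum_filter_of_ne fun Q hQ hne h0 => hne ?_
    rw [← measure_mul_setLAverage h (hσ Q (hD' hQ)), h0]
    simp
  rw [hsum]
  refine bilinear_half_of_ne_zero ha hcc hac (hD.mono hsub) (fun Q hQ => hm Q (hsub hQ))
    (fun Q hQ => hσ Q (hsub hQ)) (fun Q hQ => hω Q (hsub hQ)) hh hg (fun R hR => ?_)
    (fun Q hQ => hκ Q (Finset.filter_subset _ _ hQ)) hI hκI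
    (fun Q hQ => (Finset.mem_filter.1 hQ).2)
  refine le_trans ?_ (hT R (hsub hR))
  gcongr with x

open Classical in
/-- Two-weight bilinear estimate for positive dyadic operators under Sawyer testing conditions. -/
theorem bilinear_le {a a' c c' : ℝ} (haa : a.HolderConjugate a') (hcc : c.HolderConjugate c')
    (hac : 1 ≤ 1 / a + 1 / c) {σ ω : Measure X} {D : Finset (Set X)} (hD : IsLaminar D)
    (hm : ∀ Q ∈ D, MeasurableSet Q) (hσ : ∀ Q ∈ D, σ Q ≠ ⊤) (hω : ∀ Q ∈ D, ω Q ≠ ⊤)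
    {τ : Set X → ℝ≥0∞} {h g : X → ℝ≥0∞} (hh : Measurable h) (hg : Measurable g) {T T' : ℝ≥0∞}
    (hT : ∀ R ∈ D, (∫⁻ x, (∑ Q ∈ D with Q ⊆ R, Q.indicator (fun _ => τ Q * σ Q) x) ^ c' ∂ω)
      ^ (1 / c') ≤ T * σ R ^ (1 / a))
    (hT' : ∀ R ∈ D, (∫⁻ x, (∑ Q ∈ D with Q ⊆ R, Q.indicator (fun _ => τ Q * ω Q) x) ^ a' ∂σ)
      ^ (1 / a') ≤ T' * ω R ^ (1 / c))
    (hIh : ∫⁻ x, h x ^ a ∂σ ≠ ⊤) (hIh0 : ∫⁻ x, h x ^ a ∂σ ≠ 0)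
    (hIg : ∫⁻ x, g x ^ c ∂ω ≠ ⊤) (hIg0 : ∫⁻ x, g x ^ c ∂ω ≠ 0) :
    ∑ Q ∈ D, τ Q * (∫⁻ x in Q, h x ∂σ) * (∫⁻ x in Q, g x ∂ω) ≤
      (bilinearConst a c + bilinearConst c a) * (T + T') *
        ((∫⁻ x, h x ^ a ∂σ) ^ (1 / a) * (∫⁻ x, g x ^ c ∂ω) ^ (1 / c)) := by
  set Ih := ∫⁻ x, h x ^ a ∂σ with hIhd
  set Ig := ∫⁻ x, g x ^ c ∂ω with hIgd
  set D₁ := D.filter fun Q => (⨍⁻ x in Q, g x ∂ω) ^ c * ω Q ≤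
    Ig / Ih * ((⨍⁻ x in Q, h x ∂σ) ^ a * σ Q) with hD₁
  set D₂ := D.filter fun Q => ¬ ((⨍⁻ x in Q, g x ∂ω) ^ c * ω Q ≤
    Ig / Ih * ((⨍⁻ x in Q, h x ∂σ) ^ a * σ Q)) with hD₂
  have h₁ := bilinear_half haa.lt hcc hac hD hm hσ hω hh hg hT (Finset.filter_subset _ D)
    (fun Q hQ => (Finset.mem_filter.1 hQ).2) hIh (ENNReal.div_mul_cancel hIh0 hIh).le
  have h₂ := bilinear_half (D' := D₂) (κ := Ih / Ig) hcc.lt haa (by linarith) hD hm hω hσ hg hh hT'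
    (Finset.filter_subset _ D)
    (fun Q hQ => by
      have h1 := (not_le.1 (Finset.mem_filter.1 hQ).2).le
      calc (⨍⁻ x in Q, h x ∂σ) ^ a * σ Q
          = Ih / Ig * (Ig / Ih * ((⨍⁻ x in Q, h x ∂σ) ^ a * σ Q)) := by
            rw [← mul_assoc, ← mul_div_assoc, ENNReal.div_mul_cancel hIg0 hIg,
              ENNReal.div_self hIh0 hIh, one_mul]
        _ ≤ _ := by gcongr) hIg
    (ENNReal.div_mul_cancel hIg0 hIg).le
  rw [← Finset.sum_filter_add_sum_filter_not D (fun Q => (⨍⁻ x in Q, g x ∂ω) ^ c * ω Q ≤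
    Ig / Ih * ((⨍⁻ x in Q, h x ∂σ) ^ a * σ Q))]
  have h₂' : ∑ Q ∈ D₂, τ Q * (∫⁻ x in Q, h x ∂σ) * (∫⁻ x in Q, g x ∂ω) ≤
      bilinearConst c a * T' * Ig ^ (1 / c) * Ih ^ (1 / a) := by
    refine le_trans (le_of_eq (Finset.sum_congr rfl fun Q _ => ?_)) h₂
    ring
  calc _ ≤ bilinearConst a c * T * Ih ^ (1 / a) * Ig ^ (1 / c) +
        bilinearConst c a * T' * Ig ^ (1 / c) * Ih ^ (1 / a) := add_le_add h₁ h₂'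
    _ ≤ bilinearConst a c * (T + T') * Ih ^ (1 / a) * Ig ^ (1 / c) +
        bilinearConst c a * (T + T') * Ig ^ (1 / c) * Ih ^ (1 / a) := by
        gcongr
        · exact le_self_add
        · exact le_add_self
    _ = _ := by ring

end

section

variable {X : Type*} [MeasurableSpace X]

theorem lintegral_sum_rpow_le {ι : Type*} {s : ℝ} (hs : 1 ≤ s) (μ : Measure X) (t : Finset ι)
    (y : ι → X → ℝ≥0∞) (hy : ∀ i ∈ t, Measurable (y i)) :
    (∫⁻ x, (∑ i ∈ t, y i x) ^ s ∂μ) ^ (1 / s) ≤ ∑ i ∈ t, (∫⁻ x, y i x ^ s ∂μ) ^ (1 / s) := by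
  classical
  have hs0 : 0 < s := by linarith
  induction t using Finset.induction_on with
  | empty => simp [hs0]
  | insert i t hi ih =>
    have hyt : ∀ j ∈ t, Measurable (y j) := fun j hj => hy j (Finset.mem_insert_of_mem hj)
    simp only [Finset.sum_insert hi]
    refine le_trans ?_ (add_le_add_right (ih hyt) _)
    exact ENNReal.lintegral_Lp_add_le (hy i (Finset.mem_insert_self i t)).aemeasurable
      (Finset.measurable_fun_sum t hyt).aemeasurable hs

/-- The constant in the one-condition testing theorem. -/
def directConst (p r : ℝ) : ℝ≥0∞ := (2 ^ p * carlesonConst p) ^ (r / p)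

theorem directConst_ne_top {p r : ℝ} (hp : 1 < p) (hr : 0 < r) : directConst p r ≠ ⊤ := by
  have hp0 : 0 < p := by linarith
  exact ENNReal.rpow_ne_top_of_nonneg (by positivity) (ENNReal.mul_ne_top
    (ENNReal.rpow_ne_top_of_nonneg hp0.le (by norm_num)) (carlesonConst_ne_top hp))

open Classical in
theorem exists_isStopping_laverage {p : ℝ} (hp : 1 < p) {σ : Measure X} {D : Finset (Set X)}
    (hD : IsLaminar D) (hσ : ∀ Q ∈ D, σ Q ≠ ⊤) {f : X → ℝ≥0∞} (hI : ∫⁻ x, f x ^ p ∂σ ≠ ⊤) :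
    ∃ (P : Set X → Set X) (k : Set X → ℤ),
      IsStopping (D.filter fun Q => ⨍⁻ x in Q, f x ∂σ ≠ 0) (fun Q => ⨍⁻ x in Q, f x ∂σ) P k := by
  have hs : D.filter (fun Q => ⨍⁻ x in Q, f x ∂σ ≠ 0) ⊆ D := Finset.filter_subset _ _
  have h0 : ∀ Q ∈ D.filter (fun Q => ⨍⁻ x in Q, f x ∂σ ≠ 0), ⨍⁻ x in Q, f x ∂σ ≠ 0 :=
    fun Q hQ => (Finset.mem_filter.1 hQ).2
  exact exists_isStopping (hD.mono hs) (fun Q hQ => nonempty_of_setLAverage_ne_zero (h0 Q hQ)) h0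
    fun Q hQ => setLAverage_ne_top (setLIntegral_ne_top_of_rpow hp.le hI (hσ Q (hs hQ)))

open Classical in
/-- For `r ≥ p` a single testing condition controls the positive dyadic operator. -/
theorem testing_le_of_le {p q r : ℝ} (hp : 1 < p) (hpq : p ≤ q) (hpr : p ≤ r) {σ ω : Measure X}
    {D : Finset (Set X)} (hD : IsLaminar D) (hm : ∀ Q ∈ D, MeasurableSet Q)
    (hσ : ∀ Q ∈ D, σ Q ≠ ⊤) {lam : Set X → ℝ≥0∞} {f : X → ℝ≥0∞} (hf : Measurable f)
    (hI : ∫⁻ x, f x ^ p ∂σ ≠ ⊤) {T : ℝ≥0∞}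
    (hT : ∀ R ∈ D, (∫⁻ x, (∑ Q ∈ D with Q ⊆ R, Q.indicator (fun _ => lam Q * σ Q ^ r) x) ^ (q / r)
      ∂ω) ^ (1 / (q / r)) ≤ T * σ R ^ (r / p)) :
    (∫⁻ x, (∑ Q ∈ D, Q.indicator (fun _ => lam Q * (∫⁻ y in Q, f y ∂σ) ^ r) x) ^ (q / r) ∂ω)
      ^ (1 / (q / r)) ≤ directConst p r * T * (∫⁻ x, f x ^ p ∂σ) ^ (r / p) := by
  have hp0 : 0 < p := by linarith
  have hq0 : 0 < q := by linarith
  have hr0 : 0 < r := by linarith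
  set v : Set X → ℝ≥0∞ := fun Q => ⨍⁻ x in Q, f x ∂σ with hv
  set I := ∫⁻ x, f x ^ p ∂σ with hId
  set D₁ := D.filter fun Q => ⨍⁻ x in Q, f x ∂σ ≠ 0 with hD₁
  have hs : D₁ ⊆ D := Finset.filter_subset _ _
  obtain ⟨P, k, hP⟩ := exists_isStopping_laverage hp hD hσ hI
  set 𝓕 := D₁.image P with h𝓕
  have hFD : 𝓕 ⊆ D := by
    intro F hF
    obtain ⟨Q, hQ, rfl⟩ := Finset.mem_image.1 hF
    exact hs (hP.mem Q hQ)
  have hN : ∑ F ∈ 𝓕, v F ^ p * σ F ≤ carlesonConst p * I :=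
    sum_stopping_le hp hf (fun Q hQ => hm Q (hs hQ)) (fun Q hQ => hσ Q (hs hQ)) hP
  set Φ : Set X → X → ℝ≥0∞ := fun F x =>
    ∑ Q ∈ D₁ with P Q = F, Q.indicator (fun _ => lam Q * σ Q ^ r) x with hΦ
  have hΦm : ∀ F, Measurable (Φ F) := fun F =>
    measurable_sum_indicator _ (fun Q hQ => hm Q (hs (Finset.filter_subset _ _ hQ))) _
  have hpt : ∀ x, ∑ Q ∈ D, Q.indicator (fun _ => lam Q * (∫⁻ y in Q, f y ∂σ) ^ r) x ≤
      ∑ F ∈ 𝓕, (2 * v F) ^ r * Φ F x := by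
    intro x
    calc ∑ Q ∈ D, Q.indicator (fun _ => lam Q * (∫⁻ y in Q, f y ∂σ) ^ r) x
        = ∑ Q ∈ D₁, Q.indicator (fun _ => lam Q * (∫⁻ y in Q, f y ∂σ) ^ r) x := by
          symm
          refine Finset.sum_filter_of_ne fun Q hQ hne h0 => hne ?_
          rw [← measure_mul_setLAverage f (hσ Q hQ), h0]
          simp [hr0]
      _ = ∑ F ∈ 𝓕, ∑ Q ∈ D₁ with P Q = F,
          Q.indicator (fun _ => lam Q * (∫⁻ y in Q, f y ∂σ) ^ r) x :=
          (Finset.sum_fiberwise_of_maps_to (fun Q hQ => Finset.mem_image_of_mem P hQ) _).symm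
      _ ≤ _ := by
          refine Finset.sum_le_sum fun F hF => ?_
          rw [hΦ, Finset.mul_sum]
          refine Finset.sum_le_sum fun Q hQ => ?_
          obtain ⟨hQ1, hQ2⟩ := Finset.mem_filter.1 hQ
          by_cases hx : x ∈ Q
          · simp only [indicator_of_mem hx]
            rw [← measure_mul_setLAverage f (hσ Q (hs hQ1))]
            calc lam Q * (σ Q * v Q) ^ r ≤ lam Q * (σ Q * (2 * v F)) ^ r := by
                  gcongr
                  rw [← hQ2]
                  exact hP.le_two_mul Q hQ1
              _ = _ := by
                  rw [ENNReal.mul_rpow_of_nonneg _ _ hr0.le]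
                  ring
          · simp [hx]
  have hΦT : ∀ F ∈ 𝓕, (∫⁻ x, Φ F x ^ (q / r) ∂ω) ^ (1 / (q / r)) ≤ T * σ F ^ (r / p) := by
    intro F hF
    refine le_trans ?_ (hT F (hFD hF))
    gcongr with x
    refine Finset.sum_le_sum_of_subset fun Q hQ => ?_
    obtain ⟨hQ1, hQ2⟩ := Finset.mem_filter.1 hQ
    exact Finset.mem_filter.2 ⟨hs hQ1, hQ2 ▸ hP.subset Q hQ1⟩
  have hterm : ∀ F ∈ 𝓕, (∫⁻ x, (((2 * v F) ^ r * Φ F x) ^ (p / r)) ^ (q / p) ∂ω) ^ (1 / (q / p)) ≤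
      2 ^ p * T ^ (p / r) * (v F ^ p * σ F) := by
    intro F hF
    have e1 : ∀ x, (((2 * v F) ^ r * Φ F x) ^ (p / r)) ^ (q / p) =
        (2 * v F) ^ q * Φ F x ^ (q / r) := fun x => by
      rw [← ENNReal.rpow_mul, ENNReal.mul_rpow_of_nonneg _ _ (by positivity), ← ENNReal.rpow_mul]
      congr 2 <;> field_simp
    simp_rw [e1]
    rw [lintegral_const_mul _ ((hΦm F).pow_const _), ENNReal.mul_rpow_of_nonneg _ _ (by positivity),
      ← ENNReal.rpow_mul]
    have e2 : q * (1 / (q / p)) = p := by field_simp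
    have e3 : (1 / (q / p)) = 1 / (q / r) * (p / r) := by field_simp
    rw [e2, e3, ENNReal.rpow_mul]
    calc (2 * v F) ^ p * ((∫⁻ x, Φ F x ^ (q / r) ∂ω) ^ (1 / (q / r))) ^ (p / r)
        ≤ (2 * v F) ^ p * (T * σ F ^ (r / p)) ^ (p / r) := by
          gcongr
          exact hΦT F hF
      _ = _ := by
          rw [ENNReal.mul_rpow_of_nonneg _ _ (by positivity),
            ENNReal.mul_rpow_of_nonneg _ _ (by positivity), ← ENNReal.rpow_mul,
            show r / p * (p / r) = 1 by field_simp, ENNReal.rpow_one]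
          ring
  have e4 : ∀ z : ℝ≥0∞, z ^ (q / r) = (z ^ (p / r)) ^ (q / p) := fun z => by
    rw [← ENNReal.rpow_mul]
    congr 1
    field_simp
  have e5 : 1 / (q / r) = 1 / (q / p) * (r / p) := by field_simp
  calc _ ≤ (∫⁻ x, (∑ F ∈ 𝓕, (2 * v F) ^ r * Φ F x) ^ (q / r) ∂ω) ^ (1 / (q / r)) := by
        gcongr with x
        exact hpt x
    _ ≤ (∫⁻ x, (∑ F ∈ 𝓕, ((2 * v F) ^ r * Φ F x) ^ (p / r)) ^ (q / p) ∂ω) ^ (1 / (q / r)) := by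
        gcongr with x
        rw [e4]
        gcongr
        exact rpow_sum_le_sum_rpow (by positivity) ((div_le_one hr0).2 hpr) _ _
    _ ≤ (∑ F ∈ 𝓕, 2 ^ p * T ^ (p / r) * (v F ^ p * σ F)) ^ (r / p) := by
        rw [e5, ENNReal.rpow_mul]
        gcongr
        refine (lintegral_sum_rpow_le ((one_le_div hp0).2 hpq) ω 𝓕 _ fun F _ =>
          ((hΦm F).const_mul _).pow_const _).trans ?_
        exact Finset.sum_le_sum hterm
    _ ≤ (2 ^ p * T ^ (p / r) * (carlesonConst p * I)) ^ (r / p) := by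
        rw [← Finset.mul_sum]
        gcongr
    _ = _ := by
        rw [show 2 ^ p * T ^ (p / r) * (carlesonConst p * I) =
            (2 ^ p * carlesonConst p) * T ^ (p / r) * I by ring,
          ENNReal.mul_rpow_of_nonneg _ _ (by positivity),
          ENNReal.mul_rpow_of_nonneg _ _ (by positivity), ← ENNReal.rpow_mul T,
          show p / r * (r / p) = 1 by field_simp, ENNReal.rpow_one, directConst]

/-- A linearization of the `r`-th power of the averages of `f`. -/
theorem exists_rpow_laverage_le {p r : ℝ} (hp : 1 < p) (hr : 0 < r) {σ : Measure X}
    {D : Finset (Set X)} (hD : IsLaminar D) (hm : ∀ Q ∈ D, MeasurableSet Q)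
    (hσ : ∀ Q ∈ D, σ Q ≠ ⊤) {f : X → ℝ≥0∞} (hf : Measurable f) (hI : ∫⁻ x, f x ^ p ∂σ ≠ ⊤) :
    ∃ h : X → ℝ≥0∞, Measurable h ∧
      ∫⁻ x, h x ^ (p / r) ∂σ ≤ 2 ^ p * carlesonConst p * ∫⁻ x, f x ^ p ∂σ ∧
      ∀ Q ∈ D, (⨍⁻ x in Q, f x ∂σ) ^ r * σ Q ≤ ∫⁻ x in Q, h x ∂σ := by
  classical
  have hp0 : 0 < p := by linarith
  obtain ⟨P, k, hP⟩ := exists_isStopping_laverage hp hD hσ hI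
  set v : Set X → ℝ≥0∞ := fun Q => ⨍⁻ x in Q, f x ∂σ with hv
  set D₁ := D.filter fun Q => ⨍⁻ x in Q, f x ∂σ ≠ 0 with hD₁
  have hs : D₁ ⊆ D := Finset.filter_subset _ _
  set 𝓕 := D₁.image P with h𝓕
  have hFm : ∀ F ∈ 𝓕, MeasurableSet F := by
    intro F hF
    obtain ⟨Q, hQ, rfl⟩ := Finset.mem_image.1 hF
    exact hm _ (hs (hP.mem Q hQ))
  have hN : ∑ F ∈ 𝓕, v F ^ p * σ F ≤ carlesonConst p * ∫⁻ x, f x ^ p ∂σ :=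
    sum_stopping_le hp hf (fun Q hQ => hm Q (hs hQ)) (fun Q hQ => hσ Q (hs hQ)) hP
  set w : X → ℝ≥0∞ := fun x => ∑ F ∈ 𝓕, F.indicator (fun _ => (2 * v F) ^ p) x with hw
  have hwm : Measurable w := measurable_sum_indicator 𝓕 hFm _
  refine ⟨fun x => w x ^ (r / p), hwm.pow_const _, ?_, fun Q hQ => ?_⟩
  · have e : ∀ x, (w x ^ (r / p)) ^ (p / r) = w x := fun x => by
      rw [← ENNReal.rpow_mul, show r / p * (p / r) = 1 by field_simp, ENNReal.rpow_one]
    simp_rw [e, hw]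
    rw [lintegral_finsetSum _ fun F hF => measurable_const.indicator (hFm F hF), mul_assoc]
    refine le_trans (le_of_eq ?_) (mul_le_mul_right hN _)
    rw [Finset.mul_sum]
    refine Finset.sum_congr rfl fun F hF => ?_
    rw [lintegral_indicator_const (hFm F hF), ENNReal.mul_rpow_of_nonneg _ _ hp0.le, mul_assoc]
  · by_cases hQ0 : v Q = 0
    · rw [show ⨍⁻ x in Q, f x ∂σ = 0 from hQ0, ENNReal.zero_rpow_of_pos hr, zero_mul]
      exact zero_le
    have hQ₁ : Q ∈ D₁ := Finset.mem_filter.2 ⟨hQ, hQ0⟩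
    rw [← setLIntegral_const]
    refine setLIntegral_mono (hwm.pow_const _) fun x hx => ?_
    calc v Q ^ r ≤ (2 * v (P Q)) ^ r := by
          gcongr
          exact hP.le_two_mul Q hQ₁
      _ = ((2 * v (P Q)) ^ p) ^ (r / p) := by
          rw [← ENNReal.rpow_mul]
          congr 1
          field_simp
      _ ≤ w x ^ (r / p) := by
          gcongr
          refine le_trans ?_ (Finset.single_le_sum
            (f := fun F : Set X => F.indicator (fun _ => (2 * v F) ^ p) x) (fun _ _ => zero_le)
            (Finset.mem_image_of_mem P hQ₁))
          rw [indicator_of_mem (hP.subset Q hQ₁ hx)]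

/-- The constant in the two-condition testing theorem. -/
def dualConst (p q r : ℝ) : ℝ≥0∞ :=
  (bilinearConst (p / r) ((q / r) / (q / r - 1)) +
    bilinearConst ((q / r) / (q / r - 1)) (p / r)) * directConst p r

theorem dualConst_ne_top {p q r : ℝ} (hp : 1 < p) (hpq : p ≤ q) (hr : 0 < r) (hrp : r < p) :
    dualConst p q r ≠ ⊤ := by
  have h1 : 1 < p / r := (one_lt_div hr).2 hrp
  have h2 : 1 < q / r := (one_lt_div hr).2 (hrp.trans_le hpq)
  have h3 := Real.HolderConjugate.conjExponent h2
  exact ENNReal.mul_ne_top (ENNReal.add_ne_top.2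
    ⟨bilinearConst_ne_top h1 h3.symm.pos, bilinearConst_ne_top h3.symm.lt (by linarith)⟩)
    (directConst_ne_top hp hr)

open Classical in
/-- For `r < p` the two testing conditions control the positive dyadic operator. -/
theorem testing_le_of_lt {p q r : ℝ} (hp : 1 < p) (hpq : p ≤ q) (hr : 0 < r) (hrp : r < p)
    {σ ω : Measure X} {D : Finset (Set X)} (hD : IsLaminar D) (hm : ∀ Q ∈ D, MeasurableSet Q)
    (hσ : ∀ Q ∈ D, σ Q ≠ ⊤) (hσ0 : ∀ Q ∈ D, σ Q ≠ 0) (hω : ∀ Q ∈ D, ω Q ≠ ⊤)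
    {lam : Set X → ℝ≥0∞} (hlam : ∀ Q ∈ D, lam Q ≠ ⊤) {f : X → ℝ≥0∞} (hf : Measurable f)
    (hI : ∫⁻ x, f x ^ p ∂σ ≠ ⊤) {T T' : ℝ≥0∞}
    (hT : ∀ R ∈ D, (∫⁻ x, (∑ Q ∈ D with Q ⊆ R, Q.indicator (fun _ => lam Q * σ Q ^ r) x) ^ (q / r)
      ∂ω) ^ (1 / (q / r)) ≤ T * σ R ^ (r / p))
    (hT' : ∀ R ∈ D, (∫⁻ x, (∑ Q ∈ D with Q ⊆ R,
      Q.indicator (fun _ => lam Q * σ Q ^ (r - 1) * ω Q) x) ^ ((p / r) / (p / r - 1)) ∂σ)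
        ^ (1 / ((p / r) / (p / r - 1))) ≤ T' * ω R ^ (1 - r / q)) :
    (∫⁻ x, (∑ Q ∈ D, Q.indicator (fun _ => lam Q * (∫⁻ y in Q, f y ∂σ) ^ r) x) ^ (q / r) ∂ω)
      ^ (1 / (q / r)) ≤ dualConst p q r * (T + T') * (∫⁻ x, f x ^ p ∂σ) ^ (r / p) := by
  have hp0 : 0 < p := by linarith
  have hq0 : 0 < q := by linarith
  have h1 : 1 < p / r := (one_lt_div hr).2 hrp
  have h2 : 1 < q / r := (one_lt_div hr).2 (hrp.trans_le hpq)
  have haa : (p / r).HolderConjugate ((p / r) / (p / r - 1)) :=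
    Real.HolderConjugate.conjExponent h1
  have hbb : (q / r).HolderConjugate ((q / r) / (q / r - 1)) :=
    Real.HolderConjugate.conjExponent h2
  set a := p / r with ha
  set b := q / r with hb
  set a' := a / (a - 1) with ha'
  set c := b / (b - 1) with hc
  have hb0 : 0 < b := by linarith
  have hc1 : 1 / c = 1 - r / q := by
    rw [hc, hb]
    field_simp
  have ha1 : 1 / a = r / p := by rw [ha, one_div_div]
  have hb1 : 1 / b = r / q := by rw [hb, one_div_div]
  have hac : 1 ≤ 1 / a + 1 / c := by
    have : r / q ≤ r / p := by gcongr
    rw [hc1, ha1]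
    linarith
  have hbc : 1 / b + 1 / c = 1 := by rw [hb1, hc1]; ring
  set F : X → ℝ≥0∞ := fun x =>
    ∑ Q ∈ D, Q.indicator (fun _ => lam Q * (∫⁻ y in Q, f y ∂σ) ^ r) x with hF
  have hFm : Measurable F := measurable_sum_indicator D hm _
  have hfQ : ∀ Q ∈ D, ∫⁻ y in Q, f y ∂σ ≠ ⊤ := fun Q hQ =>
    setLIntegral_ne_top_of_rpow hp.le hI (hσ Q hQ)
  set J := ∫⁻ x, F x ^ b ∂ω with hJ
  by_cases hJ0 : J = 0
  · rw [hJ0, ENNReal.zero_rpow_of_pos (by positivity)]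
    exact zero_le
  have hJt : J ≠ ⊤ := by
    have hL : J ^ (1 / b) ≤ ∑ Q ∈ D, (∫⁻ x, (Q.indicator (fun _ =>
        lam Q * (∫⁻ y in Q, f y ∂σ) ^ r) x) ^ b ∂ω) ^ (1 / b) :=
      lintegral_sum_rpow_le h2.le ω D _ fun Q hQ => measurable_const.indicator (hm Q hQ)
    have hR : ∑ Q ∈ D, (∫⁻ x, (Q.indicator (fun _ =>
        lam Q * (∫⁻ y in Q, f y ∂σ) ^ r) x) ^ b ∂ω) ^ (1 / b) ≠ ⊤ := by
      refine ENNReal.sum_ne_top.2 fun Q hQ => ENNReal.rpow_ne_top_of_nonneg (by positivity) ?_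
      have e : ∀ x, (Q.indicator (fun _ => lam Q * (∫⁻ y in Q, f y ∂σ) ^ r) x) ^ b =
          Q.indicator (fun _ => (lam Q * (∫⁻ y in Q, f y ∂σ) ^ r) ^ b) x := fun x => by
        by_cases hx : x ∈ Q <;> simp [hx, hb0]
      simp_rw [e]
      rw [lintegral_indicator_const (hm Q hQ)]
      exact ENNReal.mul_ne_top (ENNReal.rpow_ne_top_of_nonneg hb0.le (ENNReal.mul_ne_top (hlam Q hQ)
        (ENNReal.rpow_ne_top_of_nonneg hr.le (hfQ Q hQ)))) (hω Q hQ)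
    intro h
    rw [h, ENNReal.top_rpow_of_pos (by positivity)] at hL
    exact hR (top_le_iff.1 hL)
  obtain ⟨h, hhm, hhI, hhQ⟩ := exists_rpow_laverage_le hp hr hD hm hσ hf hI
  set τ : Set X → ℝ≥0∞ := fun Q => lam Q * σ Q ^ (r - 1) with hτ
  set g : X → ℝ≥0∞ := fun x => F x ^ (b - 1) with hg
  have hgm : Measurable g := hFm.pow_const _
  have hgJ : ∫⁻ x, g x ^ c ∂ω = J := by
    refine lintegral_congr fun x => ?_
    rw [hg, ← ENNReal.rpow_mul, hc, mul_div_cancel₀ _ (by linarith : b - 1 ≠ 0)]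
  have hσr : ∀ Q ∈ D, σ Q ^ r = σ Q ^ (r - 1) * σ Q := fun Q hQ => by
    conv_lhs => rw [show r = (r - 1) + 1 by ring, ENNReal.rpow_add _ _ (hσ0 Q hQ) (hσ Q hQ),
      ENNReal.rpow_one]
  have hJle : J ≤ ∑ Q ∈ D, τ Q * (∫⁻ x in Q, h x ∂σ) * (∫⁻ x in Q, g x ∂ω) := by
    calc J = ∫⁻ x, F x * g x ∂ω := by
          refine lintegral_congr fun x => ?_
          conv_lhs => rw [show b = 1 + (b - 1) by ring,
            ENNReal.rpow_add_of_nonneg _ _ zero_le_one (by linarith), ENNReal.rpow_one]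
      _ = ∑ Q ∈ D, (lam Q * (∫⁻ y in Q, f y ∂σ) ^ r) * ∫⁻ x in Q, g x ∂ω :=
          (sum_mul_setLIntegral ω D hm _ hgm).symm
      _ ≤ _ := by
          refine Finset.sum_le_sum fun Q hQ => ?_
          refine mul_le_mul' ?_ le_rfl
          rw [hτ, mul_assoc]
          gcongr
          rw [← measure_mul_setLAverage f (hσ Q hQ), ENNReal.mul_rpow_of_nonneg _ _ hr.le,
            hσr Q hQ, mul_assoc]
          gcongr
          rw [mul_comm]
          exact hhQ Q hQ
  have hIh : ∫⁻ x, h x ^ a ∂σ ≠ ⊤ := by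
    refine (hhI.trans_lt (ENNReal.mul_lt_top (lt_top_iff_ne_top.2 ?_) hI.lt_top)).ne
    exact ENNReal.mul_ne_top (ENNReal.rpow_ne_top_of_nonneg hp0.le (by norm_num))
      (carlesonConst_ne_top hp)
  have hIh0 : ∫⁻ x, h x ^ a ∂σ ≠ 0 := by
    intro h0
    rw [lintegral_eq_zero_iff (hhm.pow_const _)] at h0
    have hz : ∀ Q ∈ D, ∫⁻ x in Q, h x ∂σ = 0 := by
      intro Q _
      refine le_antisymm ((setLIntegral_le_lintegral _ _).trans_eq ?_) zero_le
      rw [lintegral_eq_zero_iff hhm]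
      filter_upwards [h0] with x hx
      simpa [(by linarith : 0 < a), (by linarith : ¬ a < 0)] using hx
    refine hJ0 (le_antisymm (hJle.trans_eq (Finset.sum_eq_zero fun Q hQ => ?_)) zero_le)
    rw [hz Q hQ]
    simp
  have hbil := bilinear_le (τ := τ) haa hbb.symm hac hD hm hσ hω hhm hgm (T := T) (T' := T')
    (fun R hR => by
      rw [ha1]
      refine le_trans (le_of_eq ?_) (hT R hR)
      congr 2 with x
      congr 1
      refine Finset.sum_congr rfl fun Q hQ => ?_
      rw [hσr Q (Finset.filter_subset _ _ hQ), mul_assoc])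
    (fun R hR => by
      rw [hc1]
      exact hT' R hR) hIh hIh0 (by rwa [hgJ]) (by rwa [hgJ])
  rw [hgJ] at hbil
  have hfin := hJle.trans hbil
  set B := bilinearConst a c + bilinearConst c a with hB
  have hJsplit : J = J ^ (1 / b) * J ^ (1 / c) := by
    rw [← ENNReal.rpow_add _ _ hJ0 hJt, hbc, ENNReal.rpow_one]
  have hcanc : J ^ (1 / b) ≤ B * (T + T') * (∫⁻ x, h x ^ a ∂σ) ^ (1 / a) := by
    have hc0 : 0 < c := hbb.symm.pos
    have hx0 : J ^ (1 / c) ≠ 0 := (ENNReal.rpow_pos (pos_iff_ne_zero.2 hJ0) hJt).ne'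
    have hxt : J ^ (1 / c) ≠ ⊤ := ENNReal.rpow_ne_top_of_nonneg (by positivity) hJt
    rw [← ENNReal.mul_le_mul_iff_left hx0 hxt, ← hJsplit, mul_assoc (B * (T + T'))]
    exact hfin
  calc J ^ (1 / b) ≤ B * (T + T') * (∫⁻ x, h x ^ a ∂σ) ^ (1 / a) := hcanc
    _ ≤ B * (T + T') * (2 ^ p * carlesonConst p * ∫⁻ x, f x ^ p ∂σ) ^ (r / p) := by
        rw [ha1]
        gcongr
    _ = _ := by
        rw [ENNReal.mul_rpow_of_nonneg _ _ (by positivity), dualConst, directConst]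
        ring

end

namespace Cube

variable {n : ℕ}

/-- The half-open version of a cube. -/
def halfOpen (Q : Cube n) : Set (Fin n → ℝ) :=
  Set.univ.pi fun i => Ico (Q.corner i) (Q.corner i + Q.side)

theorem mem_halfOpen {Q : Cube n} {x : Fin n → ℝ} :
    x ∈ Q.halfOpen ↔ ∀ i, Q.corner i ≤ x i ∧ x i < Q.corner i + Q.side := by
  simp [halfOpen, Set.mem_pi]

theorem carrier_eq_Icc (Q : Cube n) :
    Q.carrier = Icc Q.corner fun i => Q.corner i + Q.side := by
  ext x
  simp [carrier, Pi.le_def, forall_and]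

theorem closure_halfOpen (Q : Cube n) : closure Q.halfOpen = Q.carrier := by
  have h : ∀ i, closure (Ico (Q.corner i) (Q.corner i + Q.side)) =
      Icc (Q.corner i) (Q.corner i + Q.side) := fun i =>
    closure_Ico (by linarith [Q.side_pos])
  rw [halfOpen, closure_pi_set, carrier_eq_Icc, ← Set.pi_univ_Icc]
  simp only [h]

theorem measurableSet_halfOpen (Q : Cube n) : MeasurableSet Q.halfOpen :=
  MeasurableSet.univ_pi fun _ => measurableSet_Ico

theorem measurableSet_carrier (Q : Cube n) : MeasurableSet Q.carrier := by
  rw [carrier_eq_Icc]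
  exact measurableSet_Icc

theorem halfOpen_subset_carrier (Q : Cube n) : Q.halfOpen ⊆ Q.carrier :=
  Q.closure_halfOpen ▸ subset_closure

theorem halfOpen_ae_eq_carrier (Q : Cube n) : Q.halfOpen =ᵐ[volume] Q.carrier := by
  rw [carrier_eq_Icc]
  exact Measure.univ_pi_Ico_ae_eq_Icc

theorem carrier_subset_of_halfOpen_subset {Q R : Cube n} (h : Q.halfOpen ⊆ R.halfOpen) :
    Q.carrier ⊆ R.carrier := by
  rw [← closure_halfOpen, ← closure_halfOpen]
  exact closure_mono h

theorem vol_pos (Q : Cube n) : 0 < Q.vol := pow_pos Q.side_pos n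

theorem volume_halfOpen (Q : Cube n) : volume Q.halfOpen = ENNReal.ofReal Q.vol := by
  simp [halfOpen, Real.volume_pi_Ico, vol, ENNReal.ofReal_pow Q.side_pos.le]

theorem corner_mem_halfOpen (Q : Cube n) : Q.corner ∈ Q.halfOpen :=
  mem_halfOpen.2 fun _ => ⟨le_rfl, by linarith [Q.side_pos]⟩

theorem halfOpen_injective (hn : 1 ≤ n) : Function.Injective (halfOpen (n := n)) := by
  intro Q R h
  have h1 : Q.corner = R.corner := by
    funext i
    have a := (mem_halfOpen.1 (h ▸ Q.corner_mem_halfOpen : Q.corner ∈ R.halfOpen) i).1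
    have b := (mem_halfOpen.1 (h ▸ R.corner_mem_halfOpen : R.corner ∈ Q.halfOpen) i).1
    exact le_antisymm b a
  have h2 : Q.side = R.side := by
    have hv : Q.vol = R.vol := by
      rw [← ENNReal.ofReal_eq_ofReal_iff Q.vol_pos.le R.vol_pos.le, ← volume_halfOpen, h,
        volume_halfOpen]
    exact (pow_left_inj₀ Q.side_pos.le R.side_pos.le (by omega)).1 hv
  cases Q
  cases R
  simp_all

theorem halfOpen_subset_of_mem {Q R : Cube n} (hQ : Q.IsDyadic) (hR : R.IsDyadic)
    (h : Q.side ≤ R.side) {x : Fin n → ℝ} (hxQ : x ∈ Q.halfOpen) (hxR : x ∈ R.halfOpen) :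
    Q.halfOpen ⊆ R.halfOpen := by
  obtain ⟨j, m, hs, hc⟩ := hQ
  obtain ⟨l, m', hs', hc'⟩ := hR
  have hd : (0 : ℝ) < 2 ^ (-j) := by positivity
  have hjl : l ≤ j := by
    rw [hs, hs', zpow_le_zpow_iff_right₀ (by norm_num)] at h
    omega
  obtain ⟨k, hk⟩ := Int.le.dest hjl
  have hpow : (2 : ℝ) ^ (-l) = 2 ^ k * 2 ^ (-j) := by
    rw [← zpow_natCast, ← zpow_add₀ (by norm_num)]
    congr 1
    omega
  intro y hy
  rw [mem_halfOpen] at *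
  intro i
  have hx := hxQ i
  have hx' := hxR i
  have hy' := hy i
  rw [hc, hs] at hx hy'
  rw [hc', hs', hpow] at hx' ⊢
  have h1 : m' i * 2 ^ k < m i + 1 := by
    have : (m' i : ℝ) * 2 ^ k * 2 ^ (-j) < (m i + 1) * 2 ^ (-j) := by linarith [hx'.1, hx.2]
    exact_mod_cast lt_of_mul_lt_mul_right this hd.le
  have h2 : m i < (m' i + 1) * 2 ^ k := by
    have : (m i : ℝ) * 2 ^ (-j) < (m' i + 1) * 2 ^ k * 2 ^ (-j) := by linarith [hx'.2, hx.1]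
    exact_mod_cast lt_of_mul_lt_mul_right this hd.le
  have h1' : (m' i : ℝ) * 2 ^ k ≤ m i := by exact_mod_cast Int.lt_add_one_iff.1 h1
  have h2' : (m i : ℝ) + 1 ≤ (m' i + 1) * 2 ^ k := by exact_mod_cast Int.add_one_le_iff.2 h2
  have h1d := mul_le_mul_of_nonneg_right h1' hd.le
  have h2d := mul_le_mul_of_nonneg_right h2' hd.le
  constructor <;> linarith [hy'.1, hy'.2]

theorem isLaminar_image_halfOpen {t : Finset (Cube n)} [DecidableEq (Set (Fin n → ℝ))]
    (ht : ∀ Q ∈ t, Q.IsDyadic) : IsLaminar (t.image halfOpen) := by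
  intro A hA B hB
  obtain ⟨Q, hQ, rfl⟩ := Finset.mem_image.1 hA
  obtain ⟨R, hR, rfl⟩ := Finset.mem_image.1 hB
  by_cases hd : Disjoint Q.halfOpen R.halfOpen
  · exact Or.inr (Or.inr hd)
  obtain ⟨x, hxQ, hxR⟩ := Set.not_disjoint_iff.1 hd
  rcases le_total Q.side R.side with h | h
  · exact Or.inl (halfOpen_subset_of_mem (ht Q hQ) (ht R hR) h hxQ hxR)
  · exact Or.inr (Or.inl (halfOpen_subset_of_mem (ht R hR) (ht Q hQ) h hxR hxQ))

theorem countable_setOf_isDyadic : {Q : Cube n | Q.IsDyadic}.Countable := by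
  refine (Set.countable_range fun a : ℤ × (Fin n → ℤ) =>
    (⟨fun i => (a.2 i : ℝ) * (2 : ℝ) ^ (-a.1), (2 : ℝ) ^ (-a.1), by positivity⟩ : Cube n)).mono ?_
  rintro ⟨c, s, hs⟩ ⟨j, m, h1, h2⟩
  refine ⟨(j, m), ?_⟩
  simp only at h1 h2 ⊢
  subst h1
  congr
  funext i
  exact (h2 i).symm

end Cube

section Weighted

variable {n : ℕ}

/-- The measure `w dx` of a weight `w`. -/
def weightMeasure (w : (Fin n → ℝ) → ℝ) : Measure (Fin n → ℝ) :=
  volume.withDensity fun x => ENNReal.ofReal (w x)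

theorem IsWeight.aemeasurable {w : (Fin n → ℝ) → ℝ} (hw : IsWeight w) :
    AEMeasurable (fun x => ENNReal.ofReal (w x)) volume :=
  hw.1.aestronglyMeasurable.aemeasurable.ennreal_ofReal

theorem weightMeasure_halfOpen (w : (Fin n → ℝ) → ℝ) (Q : Cube n) :
    weightMeasure w Q.halfOpen = wMass w Q := by
  rw [weightMeasure, withDensity_apply _ Q.measurableSet_halfOpen, wMass,
    setLIntegral_congr Q.halfOpen_ae_eq_carrier]

theorem wMass_ne_top {w : (Fin n → ℝ) → ℝ} (hw : IsWeight w) (Q : Cube n) : wMass w Q ≠ ⊤ := by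
  have hc : IsCompact Q.carrier := by
    rw [Q.carrier_eq_Icc]
    exact isCompact_Icc
  exact (hw.1.integrableOn_isCompact hc).lintegral_lt_top.ne

theorem eNorm_eq {w : (Fin n → ℝ) → ℝ} (hw : IsWeight w) {s : ℝ} {g : (Fin n → ℝ) → ℝ≥0∞}
    (hg : Measurable g) : eNorm s w g = (∫⁻ x, g x ^ s ∂weightMeasure w) ^ (1 / s) := by
  rw [eNorm, weightMeasure,
    lintegral_withDensity_eq_lintegral_mul₀ hw.aemeasurable (hg.pow_const s).aemeasurable]
  simp only [Pi.mul_apply, mul_comm]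

theorem wNorm_eq {w f : (Fin n → ℝ) → ℝ} (hw : IsWeight w) {s : ℝ} (hs : 0 ≤ s)
    (hf : Measurable f) :
    wNorm s w f = (∫⁻ x, ENNReal.ofReal |f x| ^ s ∂weightMeasure w) ^ (1 / s) := by
  rw [← eNorm_eq hw (by fun_prop), wNorm, eNorm]
  simp only [ENNReal.ofReal_rpow_of_nonneg (abs_nonneg _) hs]

theorem setLIntegral_mul_le {w f : (Fin n → ℝ) → ℝ} (hw : IsWeight w) (hf : Measurable f)
    (Q : Cube n) : ∫⁻ y in Q.carrier, ENNReal.ofReal (f y * w y) ≤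
      ∫⁻ y in Q.halfOpen, ENNReal.ofReal |f y| ∂weightMeasure w := by
  rw [weightMeasure, restrict_withDensity Q.measurableSet_halfOpen,
    lintegral_withDensity_eq_lintegral_mul₀ hw.aemeasurable.restrict (by fun_prop),
    ← setLIntegral_congr Q.halfOpen_ae_eq_carrier]
  refine lintegral_mono fun x => ?_
  rw [Pi.mul_apply, mul_comm, ← ENNReal.ofReal_mul (hw.2 x)]
  exact ENNReal.ofReal_le_ofReal (mul_le_mul_of_nonneg_left (le_abs_self _) (hw.2 x))

theorem measurable_cubeSum {S : Set (Cube n)} (hS : S.Countable) (g : Cube n → ℝ≥0∞) :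
    Measurable (cubeSum S g) := by
  have := hS.to_subtype
  exact Measurable.tsum fun Q => measurable_const.indicator Q.1.measurableSet_carrier

theorem sum_halfOpen_le_cubeSum {S : Set (Cube n)} {t : Finset (Cube n)} (ht : ↑t ⊆ S)
    (g : Cube n → ℝ≥0∞) (x : Fin n → ℝ) :
    ∑ Q ∈ t, Q.halfOpen.indicator (fun _ => g Q) x ≤ cubeSum S g x := by
  classical
  calc ∑ Q ∈ t, Q.halfOpen.indicator (fun _ => g Q) x
      ≤ ∑ Q ∈ t, Q.carrier.indicator (fun _ => g Q) x := Finset.sum_le_sum fun Q _ =>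
        indicator_le_indicator_of_subset Q.halfOpen_subset_carrier (fun _ => zero_le) x
    _ = ∑' Q : (t : Set (Cube n)), Q.1.carrier.indicator (fun _ => g Q.1) x :=
        (Finset.tsum_subtype' t fun Q => Q.carrier.indicator (fun _ => g Q) x).symm
    _ ≤ cubeSum S g x :=
        ENNReal.tsum_mono_subtype (fun Q : Cube n => Q.carrier.indicator (fun _ => g Q) x) ht

theorem lintegral_cubeSum_rpow_le {S : Set (Cube n)} (hS : S.Countable) {g : Cube n → ℝ≥0∞}
    {w : (Fin n → ℝ) → ℝ} {s : ℝ} (hs : 0 < s) {B : ℝ≥0∞}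
    (h : ∀ t : Finset (Cube n), ↑t ⊆ S →
      ∫⁻ x, (∑ Q ∈ t, Q.halfOpen.indicator (fun _ => g Q) x) ^ s ∂weightMeasure w ≤ B) :
    ∫⁻ x, cubeSum S g x ^ s ∂weightMeasure w ≤ B := by
  classical
  have := hS.to_subtype
  have e : ∀ x, cubeSum S g x ^ s =
      ⨆ t : Finset S, (∑ Q ∈ t, Q.1.carrier.indicator (fun _ => g Q.1) x) ^ s := fun x => by
    rw [cubeSum, ENNReal.tsum_eq_iSup_sum]
    exact (ENNReal.orderIsoRpow s hs).map_iSup _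
  simp_rw [e]
  rw [lintegral_iSup_directed]
  · refine iSup_le fun t => ?_
    refine le_trans (le_of_eq ?_) (h (t.map (Function.Embedding.subtype _)) (by simp))
    have hae : ∀ Q : S, ∀ᵐ x ∂weightMeasure w, x ∈ Q.1.halfOpen ↔ x ∈ Q.1.carrier := fun Q =>
      (withDensity_absolutelyContinuous _ _).ae_le (Filter.eventuallyEq_set.1
        Q.1.halfOpen_ae_eq_carrier)
    refine lintegral_congr_ae ?_
    filter_upwards [ae_all_iff.2 hae] with x hx
    rw [Finset.sum_map]
    congr 1
    refine Finset.sum_congr rfl fun Q _ => ?_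
    simp only [indicator, Function.Embedding.subtype_apply, hx Q]
  · intro t
    refine Measurable.aemeasurable (Measurable.pow_const ?_ _)
    exact Finset.measurable_fun_sum _ fun Q _ =>
      measurable_const.indicator Q.1.measurableSet_carrier
  · refine directed_of_isDirected_le fun t t' htt x => ?_
    exact ENNReal.rpow_le_rpow (Finset.sum_le_sum_of_subset htt) hs.le

open Classical in
theorem lintegral_sum_image_le_eNorm {S : Set (Cube n)} (hn : 1 ≤ n) (hS : S.Countable)
    {w : (Fin n → ℝ) → ℝ} (hw : IsWeight w) {s : ℝ} (hs : 0 < s) {t : Finset (Cube n)}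
    (ht : ↑t ⊆ S) (R : Cube n) (G : Set (Fin n → ℝ) → ℝ≥0∞) (g : Cube n → ℝ≥0∞)
    (hg : ∀ Q, G Q.halfOpen = g Q) :
    (∫⁻ x, (∑ A ∈ t.image Cube.halfOpen with A ⊆ R.halfOpen, A.indicator (fun _ => G A) x) ^ s
      ∂weightMeasure w) ^ (1 / s) ≤
      eNorm s w (cubeSum {Q | Q ∈ S ∧ Q.carrier ⊆ R.carrier} g) := by
  rw [eNorm_eq hw (measurable_cubeSum (hS.mono fun _ h => h.1) g)]
  gcongr with x
  rw [Finset.filter_image, Finset.sum_image (Cube.halfOpen_injective hn).injOn]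
  simp_rw [hg]
  refine sum_halfOpen_le_cubeSum (fun Q hQ => ?_) g x
  obtain ⟨h1, h2⟩ := Finset.mem_filter.1 (Finset.mem_coe.1 hQ)
  exact ⟨ht h1, Cube.carrier_subset_of_halfOpen_subset h2⟩

theorem le_mul_rpow_of_rpow_neg_mul_le {m E T : ℝ≥0∞} {s : ℝ} (hm0 : m ≠ 0) (hm : m ≠ ⊤)
    (h : m ^ (-s) * E ≤ T) : E ≤ T * m ^ s := by
  calc E = m ^ (-s) * E * m ^ s := by
        rw [mul_right_comm, ← ENNReal.rpow_add _ _ hm0 hm, neg_add_cancel, ENNReal.rpow_zero,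
          one_mul]
    _ ≤ T * m ^ s := by gcongr

open Classical in
theorem testing_of_testT {S : Set (Cube n)} (hn : 1 ≤ n) (hS : S.Countable)
    {p q r α : ℝ} {ω σ' : (Fin n → ℝ) → ℝ} (hω : IsWeight ω) (hσ : IsWeight σ') (hqr : 0 < q / r)
    {t : Finset (Cube n)} (ht : ↑t ⊆ S) {R : Cube n} (hR : R ∈ S) (hR0 : wMass σ' R ≠ 0) :
    (∫⁻ x, (∑ A ∈ t.image Cube.halfOpen with A ⊆ R.halfOpen, A.indicator
      (fun _ => volume A ^ (-(α * r)) * weightMeasure σ' A ^ r) x) ^ (q / r)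
      ∂weightMeasure ω) ^ (1 / (q / r)) ≤
      testT p q r α S ω σ' * weightMeasure σ' R.halfOpen ^ (r / p) := by
  rw [weightMeasure_halfOpen]
  refine (lintegral_sum_image_le_eNorm hn hS hω hqr ht R _ _ fun Q => ?_).trans
    (le_mul_rpow_of_rpow_neg_mul_le hR0 (wMass_ne_top hσ R) (le_iSup₂_of_le R hR le_rfl))
  rw [weightMeasure_halfOpen, Q.volume_halfOpen]

open Classical in
theorem testing_of_testTstar {S : Set (Cube n)} (hn : 1 ≤ n) (hS : S.Countable)
    {p q r α : ℝ} {ω σ' : (Fin n → ℝ) → ℝ} (hω : IsWeight ω) (hσ : IsWeight σ')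
    (hpr : 0 < (p / r) / (p / r - 1)) {t : Finset (Cube n)} (ht : ↑t ⊆ S) {R : Cube n}
    (hR : R ∈ S) :
    (∫⁻ x, (∑ A ∈ t.image Cube.halfOpen with A ⊆ R.halfOpen, A.indicator
      (fun _ => volume A ^ (-(α * r)) * weightMeasure σ' A ^ (r - 1) * weightMeasure ω A) x) ^
        ((p / r) / (p / r - 1)) ∂weightMeasure σ') ^ (1 / ((p / r) / (p / r - 1))) ≤
      testTstar p q r α S ω σ' * weightMeasure ω R.halfOpen ^ (1 - r / q) := by
  by_cases hR0 : wMass ω R = 0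
  · refine le_trans (le_of_eq ?_) zero_le
    have hz : ∀ x, ∑ A ∈ t.image Cube.halfOpen with A ⊆ R.halfOpen, A.indicator
        (fun _ => volume A ^ (-(α * r)) * weightMeasure σ' A ^ (r - 1) * weightMeasure ω A) x
          = 0 := fun x => by
      refine Finset.sum_eq_zero fun A hA => ?_
      rw [measure_mono_null (μ := weightMeasure ω) (Finset.mem_filter.1 hA).2
        (by rwa [weightMeasure_halfOpen])]
      simp
    simp_rw [hz, ENNReal.zero_rpow_of_pos hpr, lintegral_zero]
    exact ENNReal.zero_rpow_of_pos (by positivity)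
  rw [weightMeasure_halfOpen]
  refine (lintegral_sum_image_le_eNorm hn hS hσ hpr ht R _ _ fun Q => ?_).trans
    (le_mul_rpow_of_rpow_neg_mul_le hR0 (wMass_ne_top hω R) (le_iSup₂_of_le R hR le_rfl))
  rw [weightMeasure_halfOpen, weightMeasure_halfOpen, Q.volume_halfOpen]

theorem wMass_eq_zero_or_of_testT_eq_zero {S : Set (Cube n)} (hn : 1 ≤ n) (hS : S.Countable)
    {p q r α : ℝ} {ω σ' : (Fin n → ℝ) → ℝ} (hω : IsWeight ω) (hσ : IsWeight σ') (hr : 0 < r)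
    (hqr : 0 < q / r) (hT : testT p q r α S ω σ' = 0) {R : Cube n} (hR : R ∈ S) :
    wMass σ' R = 0 ∨ wMass ω R = 0 := by
  classical
  by_contra! h
  have h1 := testing_of_testT (p := p) (α := α) hn hS hω hσ hqr (t := {R}) (by simpa using hR)
    hR h.1
  have hne : (volume R.halfOpen ^ (-(α * r)) * wMass σ' R ^ r) ^ (q / r) ≠ 0 := by
    refine (ENNReal.rpow_pos (pos_iff_ne_zero.2 (mul_ne_zero ?_ ?_)) ?_).ne'
    · refine (ENNReal.rpow_pos ?_ ?_).ne' <;> simp [Cube.volume_halfOpen, Cube.vol_pos]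
    · exact (ENNReal.rpow_pos (pos_iff_ne_zero.2 h.1) (wMass_ne_top hσ R)).ne'
    · refine ENNReal.mul_ne_top ?_ (ENNReal.rpow_ne_top_of_nonneg hr.le (wMass_ne_top hσ R))
      refine ENNReal.rpow_ne_top_of_ne_zero ?_ ?_ <;> simp [Cube.volume_halfOpen, Cube.vol_pos]
  have e : ∀ x, (∑ A ∈ ({R} : Finset (Cube n)).image Cube.halfOpen with A ⊆ R.halfOpen,
      A.indicator (fun _ => volume A ^ (-(α * r)) * weightMeasure σ' A ^ r) x) ^ (q / r) =
      R.halfOpen.indicator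
        (fun _ => (volume R.halfOpen ^ (-(α * r)) * wMass σ' R ^ r) ^ (q / r)) x := fun x => by
    rw [Finset.image_singleton, Finset.filter_singleton, if_pos subset_rfl, Finset.sum_singleton,
      weightMeasure_halfOpen]
    by_cases hx : x ∈ R.halfOpen <;> simp [hx, hqr]
  simp_rw [e] at h1
  rw [hT, zero_mul, lintegral_indicator_const R.measurableSet_halfOpen, weightMeasure_halfOpen,
    nonpos_iff_eq_zero, ENNReal.rpow_eq_zero_iff_of_pos (by positivity)] at h1
  exact mul_ne_zero hne h.2 h1

/-- The coefficient of a cube in the `r`-th power of the sparse operator. -/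
theorem sparse_coeff_le {r α : ℝ} (hr : 0 < r) {w f : (Fin n → ℝ) → ℝ} (hw : IsWeight w)
    (hf : Measurable f) (Q : Cube n) :
    (ENNReal.ofReal Q.vol ^ (-α) * ∫⁻ y in Q.carrier, ENNReal.ofReal (f y * w y)) ^ r ≤
      volume Q.halfOpen ^ (-(α * r)) *
        (∫⁻ y in Q.halfOpen, ENNReal.ofReal |f y| ∂weightMeasure w) ^ r := by
  rw [ENNReal.mul_rpow_of_nonneg _ _ hr.le, ← ENNReal.rpow_mul, Q.volume_halfOpen, neg_mul]
  exact mul_le_mul_right (ENNReal.rpow_le_rpow (setLIntegral_mul_le hw hf Q) hr.le) _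

theorem sparseOpNorm_rpow_le {S : Set (Cube n)} (hS : S.Countable) {p q r α : ℝ}
    (hp : 0 < p) (hq : 0 < q) (hr : 0 < r) {ω σ' : (Fin n → ℝ) → ℝ} (hω : IsWeight ω)
    (hσ : IsWeight σ') {U : ℝ≥0∞}
    (hU : U = 0 → ∀ Q ∈ S, wMass σ' Q = 0 ∨ wMass ω Q = 0)
    (h : ∀ f : (Fin n → ℝ) → ℝ≥0∞, Measurable f → ∫⁻ x, f x ^ p ∂weightMeasure σ' ≠ ⊤ →
      ∀ t : Finset (Cube n), ↑t ⊆ S → (∫⁻ x, (∑ Q ∈ t, Q.halfOpen.indicator (fun _ =>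
        volume Q.halfOpen ^ (-(α * r)) * (∫⁻ y in Q.halfOpen, f y ∂weightMeasure σ') ^ r) x) ^
          (q / r) ∂weightMeasure ω) ^ (1 / (q / r)) ≤
            U * (∫⁻ x, f x ^ p ∂weightMeasure σ') ^ (r / p)) :
    sparseOpNorm p q r α S ω σ' ^ r ≤ U := by
  have hqr : 0 < q / r := by positivity
  suffices hK : sparseOpNorm p q r α S ω σ' ≤ U ^ (1 / r) by
    calc _ ≤ (U ^ (1 / r)) ^ r := by gcongr
      _ = U := by rw [← ENNReal.rpow_mul, one_div_mul_cancel hr.ne', ENNReal.rpow_one]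
  refine sInf_le fun f hf => ?_
  set φ : (Fin n → ℝ) → ℝ≥0∞ := fun x => ENNReal.ofReal |f x| with hφ
  have hφm : Measurable φ := by fun_prop
  set c : Cube n → ℝ≥0∞ := fun Q => (ENNReal.ofReal Q.vol ^ (-α) *
    ∫⁻ y in Q.carrier, ENNReal.ofReal (f y * σ' y)) ^ r with hc
  have hcle : ∀ Q, c Q ≤ volume Q.halfOpen ^ (-(α * r)) *
      (∫⁻ y in Q.halfOpen, φ y ∂weightMeasure σ') ^ r := fun Q => sparse_coeff_le hr hσ hf Q
  have hL : eNorm q ω (sparseOp S r α fun y => f y * σ' y) =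
      (∫⁻ x, cubeSum S c x ^ (q / r) ∂weightMeasure ω) ^ (1 / q) := by
    refine (eNorm_eq hω ((measurable_cubeSum hS c).pow_const (1 / r))).trans ?_
    simp only [← ENNReal.rpow_mul, one_div_mul_eq_div]
  rw [hL, wNorm_eq hσ hp.le hf]
  by_cases hU0 : U = 0
  · refine le_trans (le_of_eq ?_) zero_le
    rw [ENNReal.rpow_eq_zero_iff_of_pos (by positivity), ← nonpos_iff_eq_zero]
    refine lintegral_cubeSum_rpow_le hS hqr fun t ht => ?_
    have hz : ∀ Q ∈ t, ∀ᵐ x ∂weightMeasure ω, Q.halfOpen.indicator (fun _ => c Q) x = 0 := by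
      intro Q hQ
      rcases hU hU0 Q (ht hQ) with h0 | h0
      · refine Filter.Eventually.of_forall fun x => ?_
        have : c Q = 0 := by
          refine le_antisymm ((hcle Q).trans_eq ?_) zero_le
          rw [setLIntegral_measure_zero _ _ (by rwa [weightMeasure_halfOpen]),
            ENNReal.zero_rpow_of_pos hr, mul_zero]
        simp [this]
      · rw [← weightMeasure_halfOpen] at h0
        filter_upwards [measure_eq_zero_iff_ae_notMem.1 h0] with x hx
        exact indicator_of_notMem hx _
    have hz' := (Finset.eventually_all t).2 hz
    refine le_of_eq ((lintegral_congr_ae ?_).trans lintegral_zero)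
    filter_upwards [hz'] with x hx
    rw [Finset.sum_eq_zero hx, ENNReal.zero_rpow_of_pos hqr]
  set I := ∫⁻ x, φ x ^ p ∂weightMeasure σ' with hI
  by_cases hIt : I = ⊤
  · rw [hIt, ENNReal.top_rpow_of_pos (by positivity), ENNReal.mul_top]
    · exact le_top
    · simpa [ENNReal.rpow_eq_zero_iff, hU0] using fun _ => hr.le
  have hB : ∫⁻ x, cubeSum S c x ^ (q / r) ∂weightMeasure ω ≤ (U * I ^ (r / p)) ^ (q / r) := by
    refine lintegral_cubeSum_rpow_le hS hqr fun t ht => ?_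
    have h1 := ENNReal.rpow_le_rpow (h φ hφm hIt t ht) hqr.le
    rw [← ENNReal.rpow_mul, one_div_mul_cancel hqr.ne', ENNReal.rpow_one] at h1
    refine le_trans (lintegral_mono fun x => ?_) h1
    refine ENNReal.rpow_le_rpow (Finset.sum_le_sum fun Q _ => ?_) hqr.le
    exact indicator_le_indicator (hcle Q)
  calc _ ≤ ((U * I ^ (r / p)) ^ (q / r)) ^ (1 / q) := by gcongr
    _ = U ^ (1 / r) * I ^ (1 / p) := by
        rw [← ENNReal.rpow_mul, ENNReal.mul_rpow_of_nonneg _ _ (by positivity),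
          ← ENNReal.rpow_mul]
        congr 2 <;> field_simp

open Classical in
theorem lintegral_sum_halfOpen_eq {μ ν : Measure (Fin n → ℝ)} (hn : 1 ≤ n) {r s : ℝ}
    (hr : 0 < r) (t : Finset (Cube n)) (f : (Fin n → ℝ) → ℝ≥0∞)
    (lam : Set (Fin n → ℝ) → ℝ≥0∞) :
    ∫⁻ x, (∑ Q ∈ t, Q.halfOpen.indicator (fun _ => lam Q.halfOpen *
      (∫⁻ y in Q.halfOpen, f y ∂μ) ^ r) x) ^ s ∂ν =
    ∫⁻ x, (∑ A ∈ (t.filter fun Q => μ Q.halfOpen ≠ 0).image Cube.halfOpen,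
      A.indicator (fun _ => lam A * (∫⁻ y in A, f y ∂μ) ^ r) x) ^ s ∂ν := by
  refine lintegral_congr fun x => ?_
  rw [Finset.sum_image (Cube.halfOpen_injective hn).injOn]
  congr 1
  symm
  refine Finset.sum_filter_of_ne fun Q _ hne h0 => hne ?_
  rw [setLIntegral_measure_zero _ _ h0, ENNReal.zero_rpow_of_pos hr]
  simp

end Weighted

/-- domination of the operator norm of `A^{r,α}_S(·σ) : L^p_σ → L^q_ω` by the
testing constants `𝒯` and `𝒯*` (the constant is independent of `α`, `𝒮`, `ω`, `σ`). -/
theorem stmt3 (n : ℕ) (hn : 1 ≤ n) (p q r η : ℝ)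
    (hp : 1 < p) (hpq : p ≤ q) (hr : 0 < r) (hη : 0 < η) (hη1 : η ≤ 1) :
    ∃ C : ℝ, 0 < C ∧
      ∀ α : ℝ, 0 < α → α ≤ 1 →
      ∀ (S : Set (Cube n)), (∀ Q ∈ S, Q.IsDyadic) → IsSparse η S →
      ∀ ω σ' : (Fin n → ℝ) → ℝ, IsWeight ω → IsWeight σ' →
        (r < p →
          sparseOpNorm p q r α S ω σ' ^ r ≤
            ENNReal.ofReal C * (testT p q r α S ω σ' + testTstar p q r α S ω σ')) ∧
        (p ≤ r →
          sparseOpNorm p q r α S ω σ' ^ r ≤ ENNReal.ofReal C * testT p q r α S ω σ') := by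
  classical
  have hp0 : 0 < p := by linarith
  have hq0 : 0 < q := by linarith
  have hqr : 0 < q / r := by positivity
  refine ⟨(dualConst p q r).toReal + (directConst p r).toReal + 1, by positivity, ?_⟩
  intro α _ _ S hdy _ ω σ' hω hσ
  have hS : S.Countable := Cube.countable_setOf_isDyadic.mono hdy
  set C := ENNReal.ofReal ((dualConst p q r).toReal + (directConst p r).toReal + 1) with hC
  have hC0 : C ≠ 0 := by
    rw [hC, Ne, ENNReal.ofReal_eq_zero, not_le]
    positivity
  have hCdual : dualConst p q r ≠ ⊤ → dualConst p q r ≤ C := fun h => by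
    rw [← ENNReal.ofReal_toReal h]
    exact ENNReal.ofReal_le_ofReal (by linarith [(directConst p r).toReal_nonneg])
  have hCdirect : directConst p r ≤ C := by
    rw [← ENNReal.ofReal_toReal (directConst_ne_top hp hr)]
    exact ENNReal.ofReal_le_ofReal (by linarith [(dualConst p q r).toReal_nonneg])
  have hzero := fun (h : testT p q r α S ω σ' = 0) (R : Cube n) (hR : R ∈ S) =>
    wMass_eq_zero_or_of_testT_eq_zero hn hS hω hσ hr hqr h hR
  have hfin : ∀ {w : (Fin n → ℝ) → ℝ}, IsWeight w → ∀ t : Finset (Cube n),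
      ∀ A ∈ t.image Cube.halfOpen, weightMeasure w A ≠ ⊤ := by
    intro w hw t A hA
    obtain ⟨Q, -, rfl⟩ := Finset.mem_image.1 hA
    rw [weightMeasure_halfOpen]
    exact wMass_ne_top hw Q
  have hmeas : ∀ t : Finset (Cube n), ∀ A ∈ t.image Cube.halfOpen, MeasurableSet A := by
    intro t A hA
    obtain ⟨Q, -, rfl⟩ := Finset.mem_image.1 hA
    exact Q.measurableSet_halfOpen
  have hsub : ∀ t : Finset (Cube n), ↑t ⊆ S →
      ((t.filter fun Q => weightMeasure σ' Q.halfOpen ≠ 0 : Finset (Cube n)) : Set (Cube n)) ⊆ S :=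
    fun t ht Q hQ => ht (Finset.filter_subset _ _ hQ)
  have hne : ∀ t : Finset (Cube n), ∀ A ∈ (t.filter fun Q =>
      weightMeasure σ' Q.halfOpen ≠ 0).image Cube.halfOpen, weightMeasure σ' A ≠ 0 := by
    intro t A hA
    obtain ⟨Q, hQ, rfl⟩ := Finset.mem_image.1 hA
    exact (Finset.mem_filter.1 hQ).2
  have hvol : ∀ t : Finset (Cube n), ∀ A ∈ t.image Cube.halfOpen,
      volume A ^ (-(α * r)) ≠ ⊤ := by
    intro t A hA
    obtain ⟨Q, -, rfl⟩ := Finset.mem_image.1 hA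
    refine ENNReal.rpow_ne_top_of_ne_zero ?_ ?_ <;> simp [Cube.volume_halfOpen, Cube.vol_pos]
  constructor
  · intro hrp
    refine sparseOpNorm_rpow_le hS hp0 hq0 hr hω hσ (fun h => hzero ?_) fun f hf hI t ht => ?_
    · exact (add_eq_zero.1 ((mul_eq_zero.1 h).resolve_left hC0)).1
    have h1 : 1 < p / r := (one_lt_div hr).2 hrp
    rw [lintegral_sum_halfOpen_eq hn hr t f fun A => volume A ^ (-(α * r))]
    refine (testing_le_of_lt hp hpq hr hrp
      (Cube.isLaminar_image_halfOpen fun Q hQ => hdy Q (hsub t ht hQ)) (hmeas _) (hfin hσ _)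
      (hne t) (hfin hω _) (lam := fun A => volume A ^ (-(α * r))) (hvol _) hf hI
      (fun A hA => ?_) (fun A hA => ?_)).trans
      (mul_le_mul' (mul_le_mul' (hCdual (dualConst_ne_top hp hpq hr hrp)) le_rfl) le_rfl)
    · obtain ⟨R, hR, rfl⟩ := Finset.mem_image.1 hA
      refine testing_of_testT hn hS hω hσ hqr (hsub t ht) (hsub t ht hR) ?_
      rw [← weightMeasure_halfOpen]
      exact (Finset.mem_filter.1 hR).2
    · obtain ⟨R, hR, rfl⟩ := Finset.mem_image.1 hA
      exact testing_of_testTstar hn hS hω hσ (div_pos (by linarith) (by linarith)) (hsub t ht)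
        (hsub t ht hR)
  · intro hpr
    refine sparseOpNorm_rpow_le hS hp0 hq0 hr hω hσ (fun h => hzero ?_) fun f hf hI t ht => ?_
    · exact (mul_eq_zero.1 h).resolve_left hC0
    rw [lintegral_sum_halfOpen_eq hn hr t f fun A => volume A ^ (-(α * r))]
    refine (testing_le_of_le hp hpq hpr
      (Cube.isLaminar_image_halfOpen fun Q hQ => hdy Q (hsub t ht hQ)) (hmeas _) (hfin hσ _)
      (lam := fun A => volume A ^ (-(α * r))) hf hI (fun A hA => ?_)).trans
      (mul_le_mul' (mul_le_mul' hCdirect le_rfl) le_rfl)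
    obtain ⟨R, hR, rfl⟩ := Finset.mem_image.1 hA
    refine testing_of_testT hn hS hω hσ hqr (hsub t ht) (hsub t ht hR) ?_
    rw [← weightMeasure_halfOpen]
    exact (Finset.mem_filter.1 hR).2
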